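/- The convex hull of the points x(T), taken over all triangulations T of P, equals the set of all x ∈ ℝ^{n+1} satisfying Σ_{j∈[n+1]} x_j = (n+2)(n+1)/2 and Σ_{j∈Bel(δ)} x_j ≥ (bel(δ)+1)·bel(δ)/2 for every internal diagonal δ of P; moreover this polytope has dimension n. -/

import Mathlib

attribute [local instance] Classical.propDecidable

noncomputable section

namespace Spines

/-- Position of vertex `v ∈ {0,…,n+2}` in the counterclockwise boundary cyclic order:
`0`, then the elements of `D` in increasing order, then `n+2`, then the elements of `U`
in decreasing order. -/
def pos (n : ℕ) (D U : Finset ℕ) (v : ℕ) : ℕ :=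
  if v = 0 then 0
  else if v = n + 2 then D.card + 1
  else if v ∈ D then 1 + (D.filter (fun d => d < v)).card
  else D.card + 2 + (U.filter (fun u => v < u)).card

/-- Cyclic distance from `a` to `v` in counterclockwise direction. -/
def relpos (n : ℕ) (D U : Finset ℕ) (a v : ℕ) : ℕ :=
  (pos n D U v + (n + 3) - pos n D U a) % (n + 3)

/-- `v` lies strictly inside the counterclockwise boundary arc from `a` to `b`. -/
def StrictBetween (n : ℕ) (D U : Finset ℕ) (a b v : ℕ) : Prop :=
  v ≤ n + 2 ∧ 0 < relpos n D U a v ∧ relpos n D U a v < relpos n D U a b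

/-- A diagonal, encoded as an ordered pair `(a,b)` with `a < b ≤ n+2`. -/
def IsDiag (n : ℕ) (δ : ℕ × ℕ) : Prop := δ.1 < δ.2 ∧ δ.2 ≤ n + 2

/-- A boundary edge: the endpoints are adjacent in the cyclic order. -/
def IsBoundaryEdge (n : ℕ) (D U : Finset ℕ) (δ : ℕ × ℕ) : Prop :=
  IsDiag n δ ∧ (relpos n D U δ.1 δ.2 = 1 ∨ relpos n D U δ.2 δ.1 = 1)

/-- An internal diagonal. -/
def IsInternalDiag (n : ℕ) (D U : Finset ℕ) (δ : ℕ × ℕ) : Prop :=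
  IsDiag n δ ∧ ¬ IsBoundaryEdge n D U δ

/-- Two diagonals cross: the four endpoints are pairwise distinct and exactly one
endpoint of the second lies strictly inside each of the two arcs determined by the first. -/
def Cross (n : ℕ) (D U : Finset ℕ) (δ δ' : ℕ × ℕ) : Prop :=
  δ.1 ≠ δ.2 ∧ δ'.1 ≠ δ'.2 ∧ δ.1 ≠ δ'.1 ∧ δ.1 ≠ δ'.2 ∧ δ.2 ≠ δ'.1 ∧ δ.2 ≠ δ'.2 ∧
  ((StrictBetween n D U δ.1 δ.2 δ'.1 ∧ StrictBetween n D U δ.2 δ.1 δ'.2) ∨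
   (StrictBetween n D U δ.1 δ.2 δ'.2 ∧ StrictBetween n D U δ.2 δ.1 δ'.1))

/-- A triangulation: a maximal set of pairwise non-crossing internal diagonals. -/
def IsTriangulation (n : ℕ) (D U : Finset ℕ) (T : Finset (ℕ × ℕ)) : Prop :=
  (∀ δ ∈ T, IsInternalDiag n D U δ) ∧
  (∀ δ ∈ T, ∀ δ' ∈ T, ¬ Cross n D U δ δ') ∧
  (∀ δ, IsInternalDiag n D U δ → δ ∉ T → ∃ δ' ∈ T, Cross n D U δ δ')

/-- `a` and `b` (with `a < b`) are joined by a diagonal of `T` or a boundary edge. -/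
def EdgeOf (n : ℕ) (D U : Finset ℕ) (T : Finset (ℕ × ℕ)) (a b : ℕ) : Prop :=
  (a, b) ∈ T ∨ IsBoundaryEdge n D U (a, b)

/-- `{i,j,k}` with `i<j<k` is a triangle of the triangulation `T`. -/
def IsTriangleOf (n : ℕ) (D U : Finset ℕ) (T : Finset (ℕ × ℕ)) (i j k : ℕ) : Prop :=
  i < j ∧ j < k ∧ k ≤ n + 2 ∧
    EdgeOf n D U T i j ∧ EdgeOf n D U T j k ∧ EdgeOf n D U T i k

/-- `Bel δ`: labels in `[n+1]` strictly inside the ccw arc from `δ.1` to `δ.2`,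
together with the endpoints of `δ` lying in `U`. -/
def Bel (n : ℕ) (D U : Finset ℕ) (δ : ℕ × ℕ) : Finset ℕ :=
  (Finset.Icc 1 (n + 1)).filter
    (fun j => StrictBetween n D U δ.1 δ.2 j ∨ (j ∈ U ∧ (j = δ.1 ∨ j = δ.2)))

def bel (n : ℕ) (D U : Finset ℕ) (δ : ℕ × ℕ) : ℕ := (Bel n D U δ).card

def Abo (n : ℕ) (D U : Finset ℕ) (δ : ℕ × ℕ) : Finset ℕ :=
  Finset.Icc 1 (n + 1) \ Bel n D U δ

/-- The coordinates of the point `x(T)` associated to a triangulation `T`. -/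
def xcoord (n : ℕ) (D U : Finset ℕ) (T : Finset (ℕ × ℕ)) (j : ℕ) : ℝ :=
  if h : ∃ p : ℕ × ℕ, IsTriangleOf n D U T p.1 j p.2 then
    if j ∈ D then
      ((bel n D U (h.choose.1, j) : ℝ) + 1) * ((bel n D U (j, h.choose.2) : ℝ) + 1)
    else
      ((n : ℝ) + 2) -
        (((n : ℝ) + 2) - (bel n D U (h.choose.1, j) : ℝ)) *
          (((n : ℝ) + 2) - (bel n D U (j, h.choose.2) : ℝ))
  else 0

/-- Middle vertex of the triple `{a,b,c}` with `a < b` and `c ∉ {a,b}`. -/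
def midOf (a b c : ℕ) : ℕ := if c < a then a else if c < b then c else b

/-- `c` is the third vertex of a triangle of `T` containing the diagonal `δ`. -/
def TriWith (n : ℕ) (D U : Finset ℕ) (T : Finset (ℕ × ℕ)) (δ : ℕ × ℕ) (c : ℕ) : Prop :=
  if c < δ.1 then IsTriangleOf n D U T c δ.1 δ.2
  else if c < δ.2 then IsTriangleOf n D U T δ.1 c δ.2
  else IsTriangleOf n D U T δ.1 δ.2 c

/-- `s_δ`: middle vertex of the triangle of `T` below `δ` (third vertex strictly
inside the ccw arc from `δ.1` to `δ.2`). -/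
def spineSrc (n : ℕ) (D U : Finset ℕ) (T : Finset (ℕ × ℕ)) (δ : ℕ × ℕ) : ℕ :=
  if h : ∃ c, StrictBetween n D U δ.1 δ.2 c ∧ TriWith n D U T δ c then
    midOf δ.1 δ.2 h.choose
  else 0

/-- `t_δ`: middle vertex of the triangle of `T` above `δ` (third vertex strictly
inside the ccw arc from `δ.2` to `δ.1`). -/
def spineTgt (n : ℕ) (D U : Finset ℕ) (T : Finset (ℕ × ℕ)) (δ : ℕ × ℕ) : ℕ :=
  if h : ∃ c, StrictBetween n D U δ.2 δ.1 c ∧ TriWith n D U T δ c then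
    midOf δ.1 δ.2 h.choose
  else 0

/-- `(p,q)` is an arc of the spine of `T`. -/
def SpineArc (n : ℕ) (D U : Finset ℕ) (T : Finset (ℕ × ℕ)) (p q : ℕ) : Prop :=
  ∃ δ ∈ T, spineSrc n D U T δ = p ∧ spineTgt n D U T δ = q

/-- The finite set of all triangulations of the polygon. -/
def allTri (n : ℕ) (D U : Finset ℕ) : Finset (Finset (ℕ × ℕ)) :=
  ((Finset.range (n + 3) ×ˢ Finset.range (n + 3)).filter
      (fun δ => IsInternalDiag n D U δ)).powerset.filter
    (fun T => IsTriangulation n D U T)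

end Spines

namespace Spines

/-- An order-equivalent, explicit version of `pos`. -/
def key (n : ℕ) (U : Finset ℕ) (v : ℕ) : ℕ := if v ∈ U then 2 * n + 5 - v else v

theorem mem_lower_iff {n : ℕ} {D U : Finset ℕ} (hUD : D ∪ U = Finset.Icc 1 (n + 1))
    (hdisj : Disjoint D U) (v : ℕ) : v ∈ D ↔ (1 ≤ v ∧ v ≤ n + 1) ∧ v ∉ U := by
  have h1 := Finset.ext_iff.1 hUD v
  have h2 : v ∈ D → v ∉ U := fun h => Finset.disjoint_left.1 hdisj h
  simp only [Finset.mem_union, Finset.mem_Icc] at h1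
  tauto

theorem bounds_of_mem_upper {n : ℕ} {D U : Finset ℕ} (hUD : D ∪ U = Finset.Icc 1 (n + 1))
    {v : ℕ} (hv : v ∈ U) : 1 ≤ v ∧ v ≤ n + 1 := by
  have h1 := Finset.ext_iff.1 hUD v
  simp only [Finset.mem_union, Finset.mem_Icc] at h1
  tauto

theorem card_lower_add_card_upper {n : ℕ} {D U : Finset ℕ}
    (hUD : D ∪ U = Finset.Icc 1 (n + 1)) (hdisj : Disjoint D U) : D.card + U.card = n + 1 := by
  rw [← Finset.card_union_of_disjoint hdisj, hUD]; simp

theorem pos_lower_bounds {n : ℕ} {D U : Finset ℕ} (hUD : D ∪ U = Finset.Icc 1 (n + 1))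
    {v : ℕ} (hv : v ∈ D) :
    pos n D U v = 1 + (D.filter (fun d => d < v)).card ∧ pos n D U v ≤ D.card := by
  have h1 := Finset.ext_iff.1 hUD v
  simp only [Finset.mem_union, Finset.mem_Icc] at h1
  have h2 : 1 ≤ v ∧ v ≤ n + 1 := by tauto
  have h3 : pos n D U v = 1 + (D.filter (fun d => d < v)).card := by
    unfold pos
    rw [if_neg (by omega), if_neg (by omega), if_pos hv]
  refine ⟨h3, ?_⟩
  have : (D.filter (fun d => d < v)).card < D.card := by
    apply Finset.card_lt_card
    refine (Finset.filter_ssubset).2 ⟨v, hv, by simp⟩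
  omega

theorem pos_upper_bounds {n : ℕ} {D U : Finset ℕ} (hUD : D ∪ U = Finset.Icc 1 (n + 1))
    (hdisj : Disjoint D U) {v : ℕ} (hv : v ∈ U) :
    pos n D U v = D.card + 2 + (U.filter (fun d => v < d)).card ∧ pos n D U v ≤ n + 2 := by
  have h2 := bounds_of_mem_upper hUD hv
  have hD : v ∉ D := fun h => Finset.disjoint_left.1 hdisj h hv
  have h3 : pos n D U v = D.card + 2 + (U.filter (fun d => v < d)).card := by
    unfold pos
    rw [if_neg (by omega), if_neg (by omega), if_neg hD]
  refine ⟨h3, ?_⟩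
  have : (U.filter (fun d => v < d)).card < U.card := by
    apply Finset.card_lt_card
    refine (Finset.filter_ssubset).2 ⟨v, hv, by simp⟩
  have := card_lower_add_card_upper hUD hdisj
  omega

theorem pos_zero {n : ℕ} {D U : Finset ℕ} : pos n D U 0 = 0 := by simp [pos]

theorem pos_last {n : ℕ} {D U : Finset ℕ} : pos n D U (n + 2) = D.card + 1 := by simp [pos]

theorem vertex_cases {n : ℕ} {D U : Finset ℕ} (hUD : D ∪ U = Finset.Icc 1 (n + 1))
    {v : ℕ} (hv : v ≤ n + 2) : v = 0 ∨ v = n + 2 ∨ v ∈ D ∨ v ∈ U := by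
  have h1 := Finset.ext_iff.1 hUD v
  simp only [Finset.mem_union, Finset.mem_Icc] at h1
  by_cases h : 1 ≤ v ∧ v ≤ n + 1
  · tauto
  · omega

theorem pos_le {n : ℕ} {D U : Finset ℕ} (hUD : D ∪ U = Finset.Icc 1 (n + 1))
    (hdisj : Disjoint D U) {v : ℕ} (hv : v ≤ n + 2) : pos n D U v ≤ n + 2 := by
  have hc := card_lower_add_card_upper hUD hdisj
  rcases vertex_cases hUD hv with rfl | rfl | h | h
  · simp [pos_zero]
  · rw [pos_last]; omega
  · have := (pos_lower_bounds hUD h).2; omega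
  · exact (pos_upper_bounds hUD hdisj h).2

theorem pos_lt_of_key_lt {n : ℕ} {D U : Finset ℕ} (hUD : D ∪ U = Finset.Icc 1 (n + 1))
    (hdisj : Disjoint D U) {a b : ℕ} (ha : a ≤ n + 2) (hb : b ≤ n + 2)
    (h : key n U a < key n U b) : pos n D U a < pos n D U b := by
  have m1 := mem_lower_iff hUD hdisj a
  have m2 := mem_lower_iff hUD hdisj b
  have u1 : a ∈ U → 1 ≤ a ∧ a ≤ n + 1 := bounds_of_mem_upper hUD
  have u2 : b ∈ U → 1 ≤ b ∧ b ≤ n + 1 := bounds_of_mem_upper hUD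
  have z1 := pos_zero (n := n) (D := D) (U := U)
  have z2 := pos_last (n := n) (D := D) (U := U)
  unfold key at h
  by_cases ha' : a ∈ U
  · by_cases hb' : b ∈ U
    · rw [if_pos ha', if_pos hb'] at h
      rw [(pos_upper_bounds hUD hdisj ha').1, (pos_upper_bounds hUD hdisj hb').1]
      have := u1 ha'
      have := u2 hb'
      have : (U.filter (fun d => a < d)).card < (U.filter (fun d => b < d)).card := by
        apply Finset.card_lt_card
        rw [Finset.ssubset_iff_of_subset]
        · exact ⟨a, by simp [ha']; omega, by simp⟩
        · intro x; simp only [Finset.mem_filter]; rintro ⟨h1, h2⟩; exact ⟨h1, by omega⟩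
      omega
    · rw [if_pos ha', if_neg hb'] at h
      have := u1 ha'
      omega
  · by_cases hb' : b ∈ U
    · have h1 := (pos_upper_bounds hUD hdisj hb').1
      rcases vertex_cases hUD ha with rfl | rfl | h | h
      · omega
      · omega
      · have := (pos_lower_bounds hUD h).2; omega
      · exact absurd h ha'
    · rw [if_neg ha', if_neg hb'] at h
      rcases vertex_cases hUD ha with rfl | rfl | h3 | h3
      · rcases vertex_cases hUD hb with rfl | rfl | h4 | h4
        · omega
        · omega
        · have := (pos_lower_bounds hUD h4).1; omega
        · exact absurd h4 hb'
      · omega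
      · have q1 := pos_lower_bounds hUD h3
        rcases vertex_cases hUD hb with rfl | rfl | h4 | h4
        · omega
        · omega
        · rw [q1.1, (pos_lower_bounds hUD h4).1]
          have : (D.filter (fun d => d < a)).card < (D.filter (fun d => d < b)).card := by
            apply Finset.card_lt_card
            rw [Finset.ssubset_iff_of_subset]
            · exact ⟨a, by simp [h3]; omega, by simp⟩
            · intro x; simp only [Finset.mem_filter]; rintro ⟨h1, h2⟩; exact ⟨h1, by omega⟩
          omega
        · exact absurd h4 hb'
      · exact absurd h3 ha'

theorem key_injOn {n : ℕ} {D U : Finset ℕ} (hUD : D ∪ U = Finset.Icc 1 (n + 1))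
    {a b : ℕ} (ha : a ≤ n + 2) (hb : b ≤ n + 2)
    (h : key n U a = key n U b) : a = b := by
  have u1 : a ∈ U → 1 ≤ a ∧ a ≤ n + 1 := bounds_of_mem_upper hUD
  have u2 : b ∈ U → 1 ≤ b ∧ b ≤ n + 1 := bounds_of_mem_upper hUD
  unfold key at h
  split_ifs at h with h1 h2 h2
  · have := u1 h1; have := u2 h2; omega
  · have := u1 h1; omega
  · have := u2 h2; omega
  · exact h

theorem pos_lt_iff {n : ℕ} {D U : Finset ℕ} (hUD : D ∪ U = Finset.Icc 1 (n + 1))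
    (hdisj : Disjoint D U) {a b : ℕ} (ha : a ≤ n + 2) (hb : b ≤ n + 2) :
    pos n D U a < pos n D U b ↔ key n U a < key n U b := by
  refine ⟨fun h => ?_, pos_lt_of_key_lt hUD hdisj ha hb⟩
  rcases lt_trichotomy (key n U a) (key n U b) with h1 | h1 | h1
  · exact h1
  · rw [key_injOn hUD ha hb h1] at h; omega
  · have := pos_lt_of_key_lt hUD hdisj hb ha h1; omega

/-- Going counterclockwise from `a`, one meets `v` strictly before `b`. -/
def Cyc (n : ℕ) (U : Finset ℕ) (a v b : ℕ) : Prop :=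
  (key n U a < key n U v ∧ key n U v < key n U b) ∨
  (key n U b < key n U a ∧ key n U a < key n U v) ∨
  (key n U v < key n U b ∧ key n U b < key n U a)

theorem strictBetween_iff_cyc {n : ℕ} {D U : Finset ℕ} (hUD : D ∪ U = Finset.Icc 1 (n + 1))
    (hdisj : Disjoint D U) {a b v : ℕ} (ha : a ≤ n + 2) (hb : b ≤ n + 2) :
    StrictBetween n D U a b v ↔ v ≤ n + 2 ∧ Cyc n U a v b := by
  unfold StrictBetween
  refine and_congr_right fun hv => ?_
  unfold Cyc
  rw [← pos_lt_iff hUD hdisj ha hv, ← pos_lt_iff hUD hdisj hv hb, ← pos_lt_iff hUD hdisj hb ha]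
  have p1 := pos_le hUD hdisj ha
  have p2 := pos_le hUD hdisj hb
  have p3 := pos_le hUD hdisj hv
  unfold relpos
  generalize pos n D U a = x at *
  generalize pos n D U b = y at *
  generalize pos n D U v = z at *
  have e : ∀ w, w ≤ n + 2 → (w + (n + 3) - x) % (n + 3) = if x ≤ w then w - x else w + (n + 3) - x := by
    intro w hw
    split_ifs with h
    · rw [show w + (n + 3) - x = (w - x) + (n + 3) by omega, Nat.add_mod_right, Nat.mod_eq_of_lt (by omega)]
    · rw [Nat.mod_eq_of_lt (by omega)]
  rw [e z p3, e y p2]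
  split_ifs <;> omega

/-- `c` lies strictly below the diagonal from `a` to `b`, where `a < b`. -/
def Below (U : Finset ℕ) (a b c : ℕ) : Prop :=
  (c ∉ U ∧ (a ∈ U ∨ a < c) ∧ (b ∈ U ∨ c < b)) ∨ (c ∈ U ∧ ((a ∈ U ∧ c < a) ∨ (b ∈ U ∧ b < c)))

/-- `c` lies strictly above the diagonal from `a` to `b`, where `a < b`. -/
def Above (U : Finset ℕ) (a b c : ℕ) : Prop :=
  (c ∈ U ∧ (a ∉ U ∨ a < c) ∧ (b ∉ U ∨ c < b)) ∨ (c ∉ U ∧ ((a ∉ U ∧ c < a) ∨ (b ∉ U ∧ b < c)))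

theorem cyc_iff_below {n : ℕ} {D U : Finset ℕ} (hUD : D ∪ U = Finset.Icc 1 (n + 1))
    {a b v : ℕ} (hab : a < b) (hb : b ≤ n + 2) (hv : v ≤ n + 2) :
    Cyc n U a v b ↔ Below U a b v := by
  have u1 : a ∈ U → 1 ≤ a ∧ a ≤ n + 1 := bounds_of_mem_upper hUD
  have u2 : b ∈ U → 1 ≤ b ∧ b ≤ n + 1 := bounds_of_mem_upper hUD
  have u3 : v ∈ U → 1 ≤ v ∧ v ≤ n + 1 := bounds_of_mem_upper hUD
  unfold Cyc Below key
  by_cases h1 : a ∈ U <;> by_cases h2 : b ∈ U <;> by_cases h3 : v ∈ U <;>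
    simp only [h1, h2, h3, if_true, if_false, not_true, not_false_iff, true_and, false_and,
      true_or, false_or, or_false, and_true, and_false, or_self, and_self, iff_true, iff_false, forall_true_left,
      false_implies] at u1 u2 u3 ⊢ <;> omega

theorem cyc_iff_above {n : ℕ} {D U : Finset ℕ} (hUD : D ∪ U = Finset.Icc 1 (n + 1))
    {a b v : ℕ} (hab : a < b) (hb : b ≤ n + 2) (hv : v ≤ n + 2) :
    Cyc n U b v a ↔ Above U a b v := by
  have u1 : a ∈ U → 1 ≤ a ∧ a ≤ n + 1 := bounds_of_mem_upper hUD
  have u2 : b ∈ U → 1 ≤ b ∧ b ≤ n + 1 := bounds_of_mem_upper hUD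
  have u3 : v ∈ U → 1 ≤ v ∧ v ≤ n + 1 := bounds_of_mem_upper hUD
  unfold Cyc Above key
  by_cases h1 : a ∈ U <;> by_cases h2 : b ∈ U <;> by_cases h3 : v ∈ U <;>
    simp only [h1, h2, h3, if_true, if_false, not_true, not_false_iff, true_and, false_and,
      true_or, false_or, or_false, and_true, and_false, or_self, and_self, iff_true, iff_false, forall_true_left,
      false_implies] at u1 u2 u3 ⊢ <;> omega

theorem mem_Bel {n : ℕ} {D U : Finset ℕ} (hUD : D ∪ U = Finset.Icc 1 (n + 1))
    (hdisj : Disjoint D U) {a b j : ℕ} (hab : a < b) (hb : b ≤ n + 2) :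
    j ∈ Bel n D U (a, b) ↔ (1 ≤ j ∧ j ≤ n + 1) ∧ (Below U a b j ∨ (j ∈ U ∧ (j = a ∨ j = b))) := by
  simp only [Bel, Finset.mem_filter, Finset.mem_Icc]
  refine and_congr_right fun hj => ?_
  rw [strictBetween_iff_cyc hUD hdisj (by omega) hb, cyc_iff_below hUD hab hb (by omega)]
  have : j ≤ n + 2 := by omega
  tauto

theorem exists_pos_eq {n : ℕ} {D U : Finset ℕ} (hUD : D ∪ U = Finset.Icc 1 (n + 1))
    (hdisj : Disjoint D U) {m : ℕ} (hm : m ≤ n + 2) : ∃ v ≤ n + 2, pos n D U v = m := by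
  have h : (Finset.range (n + 3)).image (pos n D U) = Finset.range (n + 3) := by
    apply Finset.eq_of_subset_of_card_le
    · intro x
      simp only [Finset.mem_image, Finset.mem_range]
      rintro ⟨v, hv, rfl⟩
      have := pos_le hUD hdisj (v := v) (by omega)
      omega
    · rw [Finset.card_image_of_injOn]
      intro a ha b hb hab
      simp only [Finset.coe_range, Set.mem_Iio] at ha hb
      have h1 := pos_lt_iff hUD hdisj (a := a) (b := b) (by omega) (by omega)
      have h2 := pos_lt_iff hUD hdisj (a := b) (b := a) (by omega) (by omega)
      exact key_injOn hUD (by omega) (by omega) (by omega)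
  have h2 : m ∈ (Finset.range (n + 3)).image (pos n D U) := by
    rw [h]; simp; omega
  simp only [Finset.mem_image, Finset.mem_range] at h2
  obtain ⟨v, hv, h⟩ := h2
  exact ⟨v, by omega, h⟩

theorem relpos_eq_one_iff {n : ℕ} {D U : Finset ℕ} (hUD : D ∪ U = Finset.Icc 1 (n + 1))
    (hdisj : Disjoint D U) {a b : ℕ} (ha : a ≤ n + 2) (hb : b ≤ n + 2) (hab : a ≠ b) :
    relpos n D U a b = 1 ↔ ∀ v ≤ n + 2, ¬ Cyc n U a v b := by
  constructor
  · intro h v hv hc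
    have := (strictBetween_iff_cyc hUD hdisj ha hb).2 ⟨hv, hc⟩
    unfold StrictBetween at this
    omega
  · intro h
    have h1 := pos_lt_iff hUD hdisj ha hb
    have h2 := pos_lt_iff hUD hdisj hb ha
    have hk : key n U a ≠ key n U b := fun h => hab (key_injOn hUD ha hb h)
    have p1 := pos_le hUD hdisj ha
    have p2 := pos_le hUD hdisj hb
    obtain ⟨v, hv, hpv⟩ := exists_pos_eq hUD hdisj (m := (pos n D U a + 1) % (n + 3))
      (by have := Nat.mod_lt (pos n D U a + 1) (show 0 < n + 3 by omega); omega)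
    have h3 := fun h' => h v hv ((strictBetween_iff_cyc hUD hdisj ha hb).1 h').2
    have hr : relpos n D U a v = 1 := by
      unfold relpos
      rw [hpv]
      rcases Nat.lt_or_ge (pos n D U a + 1) (n + 3) with h | h
      · rw [Nat.mod_eq_of_lt h, show pos n D U a + 1 + (n + 3) - pos n D U a = 1 + (n + 3) by omega]
        rw [Nat.add_mod_right]
        exact Nat.mod_eq_of_lt (by omega)
      · rw [show pos n D U a + 1 = n + 3 by omega, Nat.mod_self,
          show 0 + (n + 3) - pos n D U a = 1 by omega]
        exact Nat.mod_eq_of_lt (by omega)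
    have hr2 : relpos n D U a b ≠ 0 := by
      unfold relpos
      intro h0
      have := Nat.dvd_of_mod_eq_zero h0
      obtain ⟨k, hk'⟩ := this
      rcases k with _ | _ | k
      · omega
      · omega
      · have : (n + 3) * (k + 1 + 1) = (n + 3) * k + 2 * (n + 3) := by ring
        have : 0 ≤ (n + 3) * k := by positivity
        omega
    unfold StrictBetween at h3
    by_contra h4
    exact h3 ⟨hv, by omega, by omega⟩

theorem isBoundaryEdge_iff {n : ℕ} {D U : Finset ℕ} (hUD : D ∪ U = Finset.Icc 1 (n + 1))
    (hdisj : Disjoint D U) {a b : ℕ} :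
    IsBoundaryEdge n D U (a, b) ↔ (a < b ∧ b ≤ n + 2) ∧
      ((∀ v ≤ n + 2, ¬ Below U a b v) ∨ (∀ v ≤ n + 2, ¬ Above U a b v)) := by
  unfold IsBoundaryEdge IsDiag
  refine and_congr_right fun ⟨hab, hb⟩ => ?_
  simp only at hab hb ⊢
  rw [relpos_eq_one_iff hUD hdisj (by omega) hb (by omega),
    relpos_eq_one_iff hUD hdisj hb (by omega) (by omega)]
  refine or_congr ?_ ?_
  · exact forall₂_congr fun v hv => by rw [cyc_iff_below hUD hab hb hv]
  · exact forall₂_congr fun v hv => by rw [cyc_iff_above hUD hab hb hv]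

theorem cross_iff {n : ℕ} {D U : Finset ℕ} (hUD : D ∪ U = Finset.Icc 1 (n + 1))
    (hdisj : Disjoint D U) {a b c d : ℕ} (hab : a < b) (hb : b ≤ n + 2) (hcd : c < d)
    (hd : d ≤ n + 2) : Cross n D U (a, b) (c, d) ↔
      (Below U a b c ∧ Above U a b d) ∨ (Below U a b d ∧ Above U a b c) := by
  unfold Cross
  simp only
  have hc : c ≤ n + 2 := by omega
  rw [strictBetween_iff_cyc hUD hdisj (by omega) hb, cyc_iff_below hUD hab hb (by omega),
    strictBetween_iff_cyc hUD hdisj (by omega) hb, cyc_iff_below hUD hab hb (by omega),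
    strictBetween_iff_cyc hUD hdisj hb (by omega), cyc_iff_above hUD hab hb (by omega),
    strictBetween_iff_cyc hUD hdisj hb (by omega), cyc_iff_above hUD hab hb (by omega)]
  constructor
  · tauto
  · intro h
    refine ⟨by omega, by omega, ?_, ?_, ?_, ?_, by tauto⟩ <;> rintro rfl <;>
      grind [Below, Above]

theorem cross_comm {n : ℕ} {D U : Finset ℕ} (hUD : D ∪ U = Finset.Icc 1 (n + 1))
    (hdisj : Disjoint D U) {a b c d : ℕ} (hab : a < b) (hb : b ≤ n + 2) (hcd : c < d)
    (hd : d ≤ n + 2) : Cross n D U (a, b) (c, d) ↔ Cross n D U (c, d) (a, b) := by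
  rw [cross_iff hUD hdisj hab hb hcd hd, cross_iff hUD hdisj hcd hd hab hb]
  unfold Below Above
  by_cases h1 : a ∈ U <;> by_cases h2 : b ∈ U <;> by_cases h3 : c ∈ U <;> by_cases h4 : d ∈ U <;>
    simp only [h1, h2, h3, h4, not_true, not_false_iff, true_and, false_and,
      true_or, false_or, or_false, and_true, and_false, or_self, and_self] <;> grind

/-- The pairs `{a,b}` and `{c,d}` interleave in the cyclic order. -/
def Interleave (n : ℕ) (U : Finset ℕ) (a b c d : ℕ) : Prop :=
  (Cyc n U a c b ∧ Cyc n U b d a) ∨ (Cyc n U a d b ∧ Cyc n U b c a)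

theorem cross_iff_interleave {n : ℕ} {D U : Finset ℕ} (hUD : D ∪ U = Finset.Icc 1 (n + 1))
    (hdisj : Disjoint D U) {a b c d : ℕ} (hab : a < b) (hb : b ≤ n + 2) (hcd : c < d)
    (hd : d ≤ n + 2) : Cross n D U (a, b) (c, d) ↔ Interleave n U a b c d := by
  rw [cross_iff hUD hdisj hab hb hcd hd, Interleave, cyc_iff_below hUD hab hb (by omega),
    cyc_iff_below hUD hab hb (by omega), cyc_iff_above hUD hab hb (by omega),
    cyc_iff_above hUD hab hb (by omega)]

/-- `a` and `b` are joined by an edge of `T`, in either order. -/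
def Link (n : ℕ) (D U : Finset ℕ) (T : Finset (ℕ × ℕ)) (a b : ℕ) : Prop :=
  EdgeOf n D U T (min a b) (max a b)

theorem not_cross_of_isBoundaryEdge {n : ℕ} {D U : Finset ℕ}
    (hUD : D ∪ U = Finset.Icc 1 (n + 1)) (hdisj : Disjoint D U) {a b c d : ℕ}
    (h : IsBoundaryEdge n D U (a, b)) (hcd : c < d) (hd : d ≤ n + 2) :
    ¬ Cross n D U (a, b) (c, d) := by
  obtain ⟨⟨hab, hb⟩, h⟩ := (isBoundaryEdge_iff hUD hdisj).1 h
  rw [cross_iff hUD hdisj hab hb hcd hd]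
  have hc : c ≤ n + 2 := by omega
  rcases h with h | h <;> grind

theorem edgeOf_iff {n : ℕ} {D U : Finset ℕ} (hUD : D ∪ U = Finset.Icc 1 (n + 1))
    (hdisj : Disjoint D U) {T : Finset (ℕ × ℕ)} (hT : IsTriangulation n D U T) {a b : ℕ}
    (hab : a < b) (hb : b ≤ n + 2) :
    EdgeOf n D U T a b ↔ ∀ c d, (c, d) ∈ T → ¬ Interleave n U a b c d := by
  obtain ⟨h1, h2, h3⟩ := hT
  constructor
  · intro h c d hcd
    have hd := (h1 _ hcd).1
    rw [← cross_iff_interleave hUD hdisj hab hb hd.1 hd.2]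
    rcases h with h | h
    · exact h2 _ h _ hcd
    · exact not_cross_of_isBoundaryEdge hUD hdisj h hd.1 hd.2
  · intro h
    unfold EdgeOf
    by_contra hne
    push Not at hne
    obtain ⟨⟨c, d⟩, hcd, hX⟩ := h3 (a, b) ⟨⟨hab, hb⟩, hne.2⟩ hne.1
    have hd := (h1 _ hcd).1
    exact h c d hcd ((cross_iff_interleave hUD hdisj hab hb hd.1 hd.2).1 hX)

theorem edgeOf_lt {n : ℕ} {D U : Finset ℕ} {T : Finset (ℕ × ℕ)} (hT : IsTriangulation n D U T)
    {a b : ℕ} (h : EdgeOf n D U T a b) : a < b ∧ b ≤ n + 2 := by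
  rcases h with h | h
  · exact (hT.1 _ h).1
  · exact h.1

theorem not_cross_of_edgeOf {n : ℕ} {D U : Finset ℕ} (hUD : D ∪ U = Finset.Icc 1 (n + 1))
    (hdisj : Disjoint D U) {T : Finset (ℕ × ℕ)} (hT : IsTriangulation n D U T) {a b c d : ℕ}
    (h : EdgeOf n D U T a b) (h' : EdgeOf n D U T c d) : ¬ Cross n D U (a, b) (c, d) := by
  have e1 := edgeOf_lt hT h
  have e2 := edgeOf_lt hT h'
  rcases h with h | h
  · rcases h' with h' | h'
    · exact hT.2.1 _ h _ h'
    · rw [cross_comm hUD hdisj e1.1 e1.2 e2.1 e2.2]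
      exact not_cross_of_isBoundaryEdge hUD hdisj h' e1.1 e1.2
  · exact not_cross_of_isBoundaryEdge hUD hdisj h e2.1 e2.2

theorem link_iff {n : ℕ} {D U : Finset ℕ} (hUD : D ∪ U = Finset.Icc 1 (n + 1))
    (hdisj : Disjoint D U) {T : Finset (ℕ × ℕ)} (hT : IsTriangulation n D U T) {a b : ℕ}
    (hab : a ≠ b) (ha : a ≤ n + 2) (hb : b ≤ n + 2) :
    Link n D U T a b ↔ ∀ c d, (c, d) ∈ T → ¬ Interleave n U a b c d := by
  unfold Link
  rcases lt_or_gt_of_ne hab with h | h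
  · rw [min_eq_left h.le, max_eq_right h.le, edgeOf_iff hUD hdisj hT h hb]
  · rw [min_eq_right h.le, max_eq_left h.le, edgeOf_iff hUD hdisj hT h ha]
    refine forall₃_congr fun c d hcd => ?_
    unfold Interleave
    tauto

theorem cyc_split {n : ℕ} {U : Finset ℕ} {a b c x y : ℕ} (h1 : Cyc n U b x c)
    (h2 : Cyc n U b c a) (h3 : Cyc n U c y b) :
    Cyc n U b x a ∧ (key n U y = key n U a ∨ (Cyc n U c y a ∧ Cyc n U a x c) ∨
      (Cyc n U a y b ∧ Cyc n U b x a)) := by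
  unfold Cyc at *
  generalize key n U a = a' at *
  generalize key n U b = b' at *
  generalize key n U c = c' at *
  generalize key n U x = x' at *
  generalize key n U y = y' at *
  rcases h1 with h1 | h1 | h1 <;> rcases h2 with h2 | h2 | h2 <;> rcases h3 with h3 | h3 | h3 <;>
    omega

theorem exists_apex {n : ℕ} {D U : Finset ℕ} (hUD : D ∪ U = Finset.Icc 1 (n + 1))
    (hdisj : Disjoint D U) {T : Finset (ℕ × ℕ)} (hT : IsTriangulation n D U T) {a b : ℕ}
    (hab : a ≠ b) (ha : a ≤ n + 2) (hb : b ≤ n + 2) (hE : Link n D U T a b)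
    (hv : ∃ v ≤ n + 2, Cyc n U b v a) :
    ∃ c ≤ n + 2, Cyc n U b c a ∧ Link n D U T a c ∧ Link n D U T b c := by
  have mono : ∀ c v, c ≤ n + 2 → v ≤ n + 2 → Cyc n U b c v →
      relpos n D U b c < relpos n D U b v := by
    intro c v hc hv h
    have := (strictBetween_iff_cyc hUD hdisj hb hv).2 ⟨hc, h⟩
    exact this.2.2
  have ne_a : ∀ c, Cyc n U b c a → a ≠ c := by
    rintro c h rfl
    unfold Cyc at h; omega
  have ne_b : ∀ c, Cyc n U b c a → b ≠ c := by
    rintro c h rfl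
    unfold Cyc at h; omega
  set A := (Finset.range (n + 3)).filter (fun c => Cyc n U b c a) with hA
  have memA : ∀ c, c ∈ A ↔ c ≤ n + 2 ∧ Cyc n U b c a := by
    intro c; simp [hA]; intro _; omega
  have hAne : A.Nonempty := by
    obtain ⟨v, hv, h⟩ := hv
    exact ⟨v, (memA v).2 ⟨hv, h⟩⟩
  set B := A.filter (fun c => Link n D U T a c) with hB
  have hBne : B.Nonempty := by
    obtain ⟨c, hcA, hmax⟩ := Finset.exists_max_image A (relpos n D U b) hAne
    obtain ⟨hc, hbc⟩ := (memA c).1 hcA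
    refine ⟨c, ?_⟩
    simp only [hB, Finset.mem_filter]
    refine ⟨hcA, (link_iff hUD hdisj hT (ne_a c hbc) ha hc).2 ?_⟩
    have hnone : ∀ v ≤ n + 2, ¬ Cyc n U c v a := by
      intro v hv hcv
      have h1 : Cyc n U b v a ∧ Cyc n U b c v := by
        unfold Cyc at hbc hcv ⊢; omega
      have := hmax v ((memA v).2 ⟨hv, h1.1⟩)
      have := mono c v hc hv h1.2
      omega
    intro x y hxy hX
    have hd := (hT.1 _ hxy).1
    have h1 := hd.1; have h2 := hd.2
    simp only at h1 h2
    have h3 := hnone x (by omega)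
    have h4 := hnone y (by omega)
    unfold Interleave at hX
    tauto
  obtain ⟨c, hcB, hmin⟩ := Finset.exists_min_image B (relpos n D U b) hBne
  simp only [hB, Finset.mem_filter, memA] at hcB hmin
  obtain ⟨⟨hc, hbc⟩, hac⟩ := hcB
  refine ⟨c, hc, hbc, hac, (link_iff hUD hdisj hT (ne_b c hbc) hb hc).2 ?_⟩
  rw [link_iff hUD hdisj hT hab ha hb] at hE
  have hac' := (link_iff hUD hdisj hT (ne_a c hbc) ha hc).1 hac
  intro x y hxy hX
  have hd := (hT.1 _ hxy).1
  have h1 := hd.1; have h2 := hd.2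
  simp only at h1 h2
  have e1 := hE x y hxy
  have e2 := hac' x y hxy
  have key : (key n U y = key n U a ∧ Cyc n U b x a ∧ Cyc n U b x c) ∨
      (key n U x = key n U a ∧ Cyc n U b y a ∧ Cyc n U b y c) := by
    unfold Interleave at hX e1 e2
    rcases hX with hX | hX
    · obtain ⟨k1, k2 | k2 | k2⟩ := cyc_split hX.1 hbc hX.2
      · exact Or.inl ⟨k2, k1, hX.1⟩
      · exact absurd (Or.inl ⟨k2.2, k2.1⟩) e2
      · exact absurd (Or.inr k2) e1
    · obtain ⟨k1, k2 | k2 | k2⟩ := cyc_split hX.1 hbc hX.2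
      · exact Or.inr ⟨k2, k1, hX.1⟩
      · exact absurd (Or.inr ⟨k2.2, k2.1⟩) e2
      · exact absurd (Or.inl k2) e1
  have fin : ∀ z, z ≤ n + 2 → Cyc n U b z a → Cyc n U b z c → Link n D U T a z → False := by
    intro z hz h1 h2 h3
    have := hmin z ⟨⟨hz, h1⟩, h3⟩
    have := mono z c hz hc h2
    omega
  rcases key with ⟨h, h3, h4⟩ | ⟨h, h3, h4⟩
  · obtain rfl := key_injOn hUD (by omega) (by omega) h
    refine fin x (by omega) h3 h4 ?_
    rw [Link, min_eq_right h1.le, max_eq_left h1.le]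
    exact Or.inl hxy
  · obtain rfl := key_injOn hUD (by omega) (by omega) h
    refine fin y (by omega) h3 h4 ?_
    rw [Link, min_eq_left h1.le, max_eq_right h1.le]
    exact Or.inl hxy

theorem exists_apex_above {n : ℕ} {D U : Finset ℕ} (hUD : D ∪ U = Finset.Icc 1 (n + 1))
    (hdisj : Disjoint D U) {T : Finset (ℕ × ℕ)} (hT : IsTriangulation n D U T) {a b : ℕ}
    (hE : EdgeOf n D U T a b) (hv : ∃ v ≤ n + 2, Above U a b v) :
    ∃ c ≤ n + 2, Above U a b c ∧ Link n D U T a c ∧ Link n D U T b c := by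
  obtain ⟨hab, hb⟩ := edgeOf_lt hT hE
  obtain ⟨v, hv, hv'⟩ := hv
  obtain ⟨c, hc, h1, h2⟩ := exists_apex hUD hdisj hT hab.ne (by omega) hb
    (by rwa [Link, min_eq_left hab.le, max_eq_right hab.le])
    ⟨v, hv, (cyc_iff_above hUD hab hb hv).2 hv'⟩
  exact ⟨c, hc, (cyc_iff_above hUD hab hb hc).1 h1, h2⟩

theorem triangle_unique {n : ℕ} {D U : Finset ℕ} (hUD : D ∪ U = Finset.Icc 1 (n + 1))
    (hdisj : Disjoint D U) {T : Finset (ℕ × ℕ)} (hT : IsTriangulation n D U T)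
    {i j k i' k' : ℕ} (h : IsTriangleOf n D U T i j k) (h' : IsTriangleOf n D U T i' j k') :
    i = i' ∧ k = k' := by
  obtain ⟨h1, h2, h3, h4, h5, h6⟩ := h
  obtain ⟨g1, g2, g3, g4, g5, g6⟩ := h'
  have c1 := not_cross_of_edgeOf hUD hdisj hT h6 g4
  have c2 := not_cross_of_edgeOf hUD hdisj hT h6 g5
  have c3 := not_cross_of_edgeOf hUD hdisj hT g6 h4
  have c4 := not_cross_of_edgeOf hUD hdisj hT g6 h5
  rw [cross_iff hUD hdisj (by omega) (by omega) (by omega) (by omega)] at c1 c2 c3 c4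
  clear h4 h5 h6 g4 g5 g6 hT hUD hdisj
  unfold Below Above at *
  by_cases hi : i ∈ U <;> by_cases hi' : i' ∈ U <;> by_cases hk : k ∈ U <;> by_cases hk' : k' ∈ U
    <;> by_cases hj : j ∈ U <;>
    simp only [hi, hi', hk, hk', hj, not_true, not_false_iff, true_and, false_and,
      true_or, false_or, or_false, and_true, and_false, or_self, and_self]
      at c1 c2 c3 c4 <;> grind

theorem exists_triangulation_supset {n : ℕ} {D U : Finset ℕ}
    (hUD : D ∪ U = Finset.Icc 1 (n + 1)) (hdisj : Disjoint D U) {T₀ : Finset (ℕ × ℕ)}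
    (h₁ : ∀ δ ∈ T₀, IsInternalDiag n D U δ) (h₂ : ∀ δ ∈ T₀, ∀ δ' ∈ T₀, ¬ Cross n D U δ δ') :
    ∃ T, IsTriangulation n D U T ∧ T₀ ⊆ T := by
  set I := (Finset.range (n + 3) ×ˢ Finset.range (n + 3)).filter
      (fun δ => IsInternalDiag n D U δ) with hI
  have memI : ∀ δ, δ ∈ I ↔ IsInternalDiag n D U δ := by
    intro δ
    simp only [hI, Finset.mem_filter, Finset.mem_product, Finset.mem_range, and_iff_right_iff_imp]
    rintro ⟨⟨h1, h2⟩, -⟩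
    omega
  set F := I.powerset.filter (fun T => T₀ ⊆ T ∧ ∀ δ ∈ T, ∀ δ' ∈ T, ¬ Cross n D U δ δ') with hF
  have hne : F.Nonempty := ⟨T₀, by
    simp only [hF, Finset.mem_filter, Finset.mem_powerset]
    exact ⟨fun δ hδ => (memI δ).2 (h₁ δ hδ), subset_rfl, h₂⟩⟩
  obtain ⟨T, hT, hmax⟩ := Finset.exists_max_image F Finset.card hne
  simp only [hF, Finset.mem_filter, Finset.mem_powerset] at hT hmax
  obtain ⟨hTI, hT0, hTX⟩ := hT
  have hTdiag : ∀ δ ∈ T, IsInternalDiag n D U δ := fun δ hδ => (memI δ).1 (hTI hδ)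
  refine ⟨T, ⟨hTdiag, hTX, ?_⟩, hT0⟩
  intro δ hδ hδT
  by_contra hno
  push Not at hno
  have := hmax (insert δ T) ⟨?_, ?_, ?_⟩
  · rw [Finset.card_insert_of_notMem hδT] at this
    omega
  · exact Finset.insert_subset ((memI δ).2 hδ) hTI
  · exact hT0.trans (Finset.subset_insert _ _)
  · intro x hx y hy
    rcases Finset.mem_insert.1 hx with rfl | hx' <;>
      rcases Finset.mem_insert.1 hy with rfl | hy'
    · exact fun h => h.2.2.1 rfl
    · exact hno y hy'
    · have hi := (hTdiag x hx').1
      exact fun h => hno x hx' ((cross_comm hUD hdisj hi.1 hi.2 hδ.1.1 hδ.1.2).1 h)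
    · exact hTX x hx' y hy'

/-- The vertices of the path separating the labels in `S` from the other labels. -/
def pathVerts (n : ℕ) (D U S : Finset ℕ) : Finset ℕ :=
  insert 0 (insert (n + 2) ((D \ S) ∪ (U ∩ S)))

/-- The pairs of consecutive elements of a finite set of natural numbers. -/
def consecPairs (V : Finset ℕ) : Finset (ℕ × ℕ) :=
  (V ×ˢ V).filter (fun e => e.1 < e.2 ∧ ∀ v ∈ V, ¬ (e.1 < v ∧ v < e.2))

theorem mem_pathVerts {n : ℕ} {D U S : Finset ℕ} {v : ℕ} :
    v ∈ pathVerts n D U S ↔ v = 0 ∨ v = n + 2 ∨ (v ∈ D ∧ v ∉ S) ∨ (v ∈ U ∧ v ∈ S) := by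
  simp [pathVerts]

theorem mem_consecPairs {V : Finset ℕ} {a b : ℕ} :
    (a, b) ∈ consecPairs V ↔ (a ∈ V ∧ b ∈ V) ∧ a < b ∧ ∀ v ∈ V, ¬ (a < v ∧ v < b) := by
  simp [consecPairs]

theorem mem_pathVerts_le {n : ℕ} {D U S : Finset ℕ} (hUD : D ∪ U = Finset.Icc 1 (n + 1))
    {v : ℕ} (hv : v ∈ pathVerts n D U S) : v ≤ n + 2 := by
  have h1 := Finset.ext_iff.1 hUD v
  simp only [Finset.mem_union, Finset.mem_Icc] at h1
  rcases mem_pathVerts.1 hv with h | h | h | h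
  · omega
  · omega
  · have := h1.1 (Or.inl h.1); omega
  · have := h1.1 (Or.inr h.1); omega

theorem consecPairs_insert {V : Finset ℕ} {i j k : ℕ} (hj : j ∉ V) (hi : i ∈ V) (hk : k ∈ V)
    (hij : i < j) (hjk : j < k) (hV : ∀ v ∈ V, ¬ (i < v ∧ v < k)) :
    consecPairs (insert j V) = insert (i, j) (insert (j, k) ((consecPairs V).erase (i, k))) := by
  ext ⟨a, b⟩
  simp only [Finset.mem_insert, Finset.mem_erase, mem_consecPairs, Prod.mk.injEq, ne_eq]
  constructor
  · rintro ⟨⟨ha, hb⟩, hab, h⟩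
    have h1 := h j (Or.inl rfl)
    have h2 := h i (Or.inr hi)
    have h3 := h k (Or.inr hk)
    have h4 : ∀ v ∈ V, ¬ (a < v ∧ v < b) := fun v hv => h v (Or.inr hv)
    rcases ha with rfl | ha
    · rcases hb with rfl | hb
      · omega
      · have := hV b hb
        omega
    · rcases hb with rfl | hb
      · have := hV a ha
        omega
      · right; right
        exact ⟨by omega, ⟨ha, hb⟩, hab, h4⟩
  · rintro (⟨rfl, rfl⟩ | ⟨rfl, rfl⟩ | ⟨hne, ⟨ha, hb⟩, hab, h⟩)
    · refine ⟨⟨Or.inr hi, Or.inl rfl⟩, hij, ?_⟩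
      rintro v (rfl | hv)
      · omega
      · have := hV v hv; omega
    · refine ⟨⟨Or.inl rfl, Or.inr hk⟩, hjk, ?_⟩
      rintro v (rfl | hv)
      · omega
      · have := hV v hv; omega
    · refine ⟨⟨Or.inr ha, Or.inr hb⟩, hab, ?_⟩
      rintro v (rfl | hv)
      · have h1 := h i hi
        have h2 := h k hk
        have h3 := hV a ha
        have h4 := hV b hb
        omega
      · exact h v hv

theorem sum_consecPairs_insert {V : Finset ℕ} {i j k : ℕ} (hj : j ∉ V) (hi : i ∈ V)
    (hk : k ∈ V) (hij : i < j) (hjk : j < k) (hV : ∀ v ∈ V, ¬ (i < v ∧ v < k))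
    (G : ℕ × ℕ → ℝ) :
    ∑ e ∈ consecPairs (insert j V), G e
      = ∑ e ∈ consecPairs V, G e - G (i, k) + G (i, j) + G (j, k) := by
  have hmem : (i, k) ∈ consecPairs V := mem_consecPairs.2 ⟨⟨hi, hk⟩, by omega, hV⟩
  rw [consecPairs_insert hj hi hk hij hjk hV, Finset.sum_insert, Finset.sum_insert,
    ← Finset.add_sum_erase _ _ hmem]
  · ring
  · simp [mem_consecPairs, hj]
  · simp [mem_consecPairs, hj]; omega

/-- `i` and `k` are the neighbours of `j` on the path of `S`. -/
structure Nbr (n : ℕ) (D U S : Finset ℕ) (j i k : ℕ) : Prop where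
  left_mem : i ∈ pathVerts n D U S
  right_mem : k ∈ pathVerts n D U S
  left_lt : i < j
  lt_right : j < k
  eq_of_between : ∀ v ∈ pathVerts n D U S, i < v → v < k → v = j

theorem exists_nbr {n : ℕ} {D U : Finset ℕ} (S : Finset ℕ) {j : ℕ} (hj : 1 ≤ j ∧ j ≤ n + 1) :
    ∃ i k, Nbr n D U S j i k := by
  obtain ⟨i, hi, hi'⟩ := Finset.exists_max_image ((pathVerts n D U S).filter (· < j)) id
    ⟨0, by simp [mem_pathVerts]; omega⟩
  obtain ⟨k, hk, hk'⟩ := Finset.exists_min_image ((pathVerts n D U S).filter (j < ·)) id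
    ⟨n + 2, by simp [mem_pathVerts]; omega⟩
  simp only [Finset.mem_filter, id] at hi hi' hk hk'
  refine ⟨i, k, hi.1, hk.1, hi.2, hk.2, fun v hv h1 h2 => ?_⟩
  by_contra hne
  rcases lt_or_gt_of_ne hne with h | h
  · have := hi' v ⟨hv, h⟩; omega
  · have := hk' v ⟨hv, h⟩; omega

theorem pathVerts_insert_upper {n : ℕ} {D U S : Finset ℕ} (hdisj : Disjoint D U) {j : ℕ}
    (hjU : j ∈ U) : pathVerts n D U (insert j S) = insert j (pathVerts n D U S) := by
  have : j ∉ D := fun h => Finset.disjoint_left.1 hdisj h hjU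
  ext v
  simp only [Finset.mem_insert, mem_pathVerts]
  by_cases h : v = j
  · subst h; tauto
  · tauto

theorem pathVerts_insert_lower {n : ℕ} {D U S : Finset ℕ} (hdisj : Disjoint D U) {j : ℕ}
    (hjD : j ∈ D) (hjS : j ∉ S) :
    pathVerts n D U S = insert j (pathVerts n D U (insert j S)) := by
  have : j ∉ U := fun h => Finset.disjoint_left.1 hdisj hjD h
  ext v
  simp only [Finset.mem_insert, mem_pathVerts]
  by_cases h : v = j
  · subst h; tauto
  · tauto

/-- The sign of a label: `-1` for up labels and `1` for down labels. -/
def labelSign (U : Finset ℕ) (j : ℕ) : ℝ := if j ∈ U then -1 else 1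

/-- The sum of `G` over the edges of the path of `S`. -/
def pathSum (n : ℕ) (D U : Finset ℕ) (G : ℕ × ℕ → ℝ) (S : Finset ℕ) : ℝ :=
  ∑ e ∈ consecPairs (pathVerts n D U S), G e

theorem Nbr.upper_facts {n : ℕ} {D U S : Finset ℕ} (hUD : D ∪ U = Finset.Icc 1 (n + 1))
    (hdisj : Disjoint D U) {j i k : ℕ} (h : Nbr n D U S j i k) (hjS : j ∉ S) (hjU : j ∈ U) :
    j ∉ pathVerts n D U S ∧ ∀ v ∈ pathVerts n D U S, ¬ (i < v ∧ v < k) := by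
  have h1 := bounds_of_mem_upper hUD hjU
  have : j ∉ D := fun h => Finset.disjoint_left.1 hdisj h hjU
  have h2 : j ∉ pathVerts n D U S := by
    rw [mem_pathVerts]
    rintro (h | h | h | h)
    · omega
    · omega
    · tauto
    · tauto
  refine ⟨h2, fun v hv ⟨h3, h4⟩ => h2 ?_⟩
  rwa [← h.eq_of_between v hv h3 h4]

theorem Nbr.lower_facts {n : ℕ} {D U S : Finset ℕ} (hUD : D ∪ U = Finset.Icc 1 (n + 1))
    (hdisj : Disjoint D U) {j i k : ℕ} (h : Nbr n D U S j i k) (hjS : j ∉ S) (hjD : j ∈ D) :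
    j ∉ pathVerts n D U (insert j S) ∧ i ∈ pathVerts n D U (insert j S) ∧
      k ∈ pathVerts n D U (insert j S) ∧
      ∀ v ∈ pathVerts n D U (insert j S), ¬ (i < v ∧ v < k) := by
  have h1 := ((mem_lower_iff hUD hdisj j).1 hjD)
  have e := pathVerts_insert_lower (n := n) hdisj hjD hjS
  have h2 : j ∉ pathVerts n D U (insert j S) := by
    rw [mem_pathVerts]
    rintro (h | h | h | h)
    · omega
    · omega
    · simp at h
    · tauto
  have h3 := h.left_mem
  have h4 := h.right_mem
  have h5 := h.left_lt
  have h6 := h.lt_right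
  rw [e, Finset.mem_insert] at h3 h4
  refine ⟨h2, h3.resolve_left (by omega), h4.resolve_left (by omega), fun v hv ⟨h7, h8⟩ => h2 ?_⟩
  have hvj := h.eq_of_between v (by rw [e]; exact Finset.mem_insert_of_mem hv) h7 h8
  exact hvj ▸ hv

theorem mem_lower_or_mem_upper {n : ℕ} {D U : Finset ℕ} (hUD : D ∪ U = Finset.Icc 1 (n + 1))
    {j : ℕ} (hj : 1 ≤ j ∧ j ≤ n + 1) : j ∈ D ∨ j ∈ U := by
  rw [← Finset.mem_union, hUD, Finset.mem_Icc]; exact hj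

theorem pathSum_insert {n : ℕ} {D U S : Finset ℕ} (hUD : D ∪ U = Finset.Icc 1 (n + 1))
    (hdisj : Disjoint D U) {j i k : ℕ} (hj : 1 ≤ j ∧ j ≤ n + 1) (h : Nbr n D U S j i k)
    (hjS : j ∉ S) (G : ℕ × ℕ → ℝ) :
    pathSum n D U G (insert j S)
      = pathSum n D U G S - labelSign U j * (G (i, j) + G (j, k) - G (i, k)) := by
  unfold pathSum
  rcases mem_lower_or_mem_upper hUD hj with hjD | hjU
  · obtain ⟨h1, h2, h3, h4⟩ := h.lower_facts hUD hdisj hjS hjD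
    have := sum_consecPairs_insert h1 h2 h3 h.left_lt h.lt_right h4 G
    rw [← pathVerts_insert_lower hdisj hjD hjS] at this
    rw [this, labelSign, if_neg fun h => Finset.disjoint_left.1 hdisj hjD h]
    ring
  · obtain ⟨h1, h2⟩ := h.upper_facts hUD hdisj hjS hjU
    rw [pathVerts_insert_upper hdisj hjU,
      sum_consecPairs_insert h1 h.left_mem h.right_mem h.left_lt h.lt_right h2 G,
      labelSign, if_pos hjU]
    ring

theorem sum_Bel_lower {n : ℕ} {D U : Finset ℕ} (hUD : D ∪ U = Finset.Icc 1 (n + 1))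
    (hdisj : Disjoint D U) {i j k : ℕ} (hjD : j ∈ D) (hij : i < j) (hjk : j < k)
    (hk : k ≤ n + 2) (z : ℕ → ℝ) :
    ∑ l ∈ Bel n D U (i, k), z l
      = ∑ l ∈ Bel n D U (i, j), z l + z j + ∑ l ∈ Bel n D U (j, k), z l := by
  have hj := (mem_lower_iff hUD hdisj j).1 hjD
  have e : Bel n D U (i, k) = insert j (Bel n D U (i, j) ∪ Bel n D U (j, k)) := by
    ext l
    rw [Finset.mem_insert, Finset.mem_union, mem_Bel hUD hdisj (by omega) hk,
      mem_Bel hUD hdisj hij (by omega), mem_Bel hUD hdisj hjk hk]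
    grind (splits := 40) [Below]
  have hd : Disjoint (Bel n D U (i, j)) (Bel n D U (j, k)) := by
    rw [Finset.disjoint_left]
    intro l
    rw [mem_Bel hUD hdisj hij (by omega), mem_Bel hUD hdisj hjk hk]
    grind (splits := 40) [Below]
  rw [e, Finset.sum_insert, Finset.sum_union hd]
  · ring
  · rw [Finset.mem_union, mem_Bel hUD hdisj hij (by omega), mem_Bel hUD hdisj hjk hk]
    grind (splits := 40) [Below]

theorem sum_Bel_upper {n : ℕ} {D U : Finset ℕ} (hUD : D ∪ U = Finset.Icc 1 (n + 1))
    (hdisj : Disjoint D U) {i j k : ℕ} (hjU : j ∈ U) (hij : i < j) (hjk : j < k)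
    (hk : k ≤ n + 2) (z : ℕ → ℝ) :
    ∑ l ∈ Bel n D U (i, j), z l + ∑ l ∈ Bel n D U (j, k), z l
      = ∑ l ∈ Finset.Icc 1 (n + 1), z l + ∑ l ∈ Bel n D U (i, k), z l + z j := by
  have hj := bounds_of_mem_upper hUD hjU
  have e : Bel n D U (i, j) ∪ Bel n D U (j, k) = Finset.Icc 1 (n + 1) := by
    ext l
    rw [Finset.mem_union, mem_Bel hUD hdisj hij (by omega), mem_Bel hUD hdisj hjk hk,
      Finset.mem_Icc]
    grind (splits := 40) [Below]
  have e' : Bel n D U (i, j) ∩ Bel n D U (j, k) = insert j (Bel n D U (i, k)) := by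
    ext l
    rw [Finset.mem_inter, Finset.mem_insert, mem_Bel hUD hdisj hij (by omega),
      mem_Bel hUD hdisj hjk hk, mem_Bel hUD hdisj (by omega) hk]
    grind (splits := 40) [Below]
  rw [← Finset.sum_union_inter, e, e', Finset.sum_insert]
  · ring
  · rw [mem_Bel hUD hdisj (by omega) hk]
    grind (splits := 40) [Below]

theorem eq_labelSign_mul_sum_Bel {n : ℕ} {D U : Finset ℕ}
    (hUD : D ∪ U = Finset.Icc 1 (n + 1)) (hdisj : Disjoint D U) {i j k : ℕ}
    (hij : i < j) (hjk : j < k) (hk : k ≤ n + 2) {z : ℕ → ℝ}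
    (hz : ∑ l ∈ Finset.Icc 1 (n + 1), z l = 0) :
    z j = - (labelSign U j * (∑ l ∈ Bel n D U (i, j), z l + ∑ l ∈ Bel n D U (j, k), z l
      - ∑ l ∈ Bel n D U (i, k), z l)) := by
  rcases mem_lower_or_mem_upper hUD (j := j) ⟨by omega, by omega⟩ with hjD | hjU
  · rw [labelSign, if_neg fun h => Finset.disjoint_left.1 hdisj hjD h,
      sum_Bel_lower hUD hdisj hjD hij hjk hk]
    ring
  · rw [labelSign, if_pos hjU, sum_Bel_upper hUD hdisj hjU hij hjk hk, hz]
    ring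

theorem bel_lower {n : ℕ} {D U : Finset ℕ} (hUD : D ∪ U = Finset.Icc 1 (n + 1))
    (hdisj : Disjoint D U) {i j k : ℕ} (hjD : j ∈ D) (hij : i < j) (hjk : j < k)
    (hk : k ≤ n + 2) :
    (bel n D U (i, k) : ℝ) = bel n D U (i, j) + 1 + bel n D U (j, k) := by
  simpa [bel] using sum_Bel_lower hUD hdisj hjD hij hjk hk (fun _ => 1)

theorem bel_upper {n : ℕ} {D U : Finset ℕ} (hUD : D ∪ U = Finset.Icc 1 (n + 1))
    (hdisj : Disjoint D U) {i j k : ℕ} (hjU : j ∈ U) (hij : i < j) (hjk : j < k)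
    (hk : k ≤ n + 2) :
    (bel n D U (i, j) : ℝ) + bel n D U (j, k) = n + 1 + bel n D U (i, k) + 1 := by
  simpa [bel] using sum_Bel_upper hUD hdisj hjU hij hjk hk (fun _ => 1)

theorem Bel_of_isBoundaryEdge {n : ℕ} {D U : Finset ℕ} (hUD : D ∪ U = Finset.Icc 1 (n + 1))
    (hdisj : Disjoint D U) {e : ℕ × ℕ} (h : IsBoundaryEdge n D U e) :
    Bel n D U e = ∅ ∨ Bel n D U e = Finset.Icc 1 (n + 1) := by
  obtain ⟨a, b⟩ := e
  have h0 : 0 ∉ U := fun h => by have := bounds_of_mem_upper hUD h; omega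
  have h2 : n + 2 ∉ U := fun h => by have := bounds_of_mem_upper hUD h; omega
  obtain ⟨⟨hab, hb⟩, h⟩ := (isBoundaryEdge_iff hUD hdisj).1 h
  rcases h with h | h
  · left
    rw [Finset.eq_empty_iff_forall_notMem]
    intro l
    rw [mem_Bel hUD hdisj hab hb]
    have e1 := h 0 (by omega)
    have e2 := h (n + 2) (by omega)
    have e3 := h l
    grind (splits := 40) [Below]
  · right
    ext l
    rw [mem_Bel hUD hdisj hab hb, Finset.mem_Icc]
    have e1 := h 0 (by omega)
    have e2 := h (n + 2) (by omega)
    have e3 := h l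
    grind (splits := 40) [Below, Above]

theorem bel_of_isInternalDiag {n : ℕ} {D U : Finset ℕ} (hUD : D ∪ U = Finset.Icc 1 (n + 1))
    (hdisj : Disjoint D U) {e : ℕ × ℕ} (h : IsInternalDiag n D U e) :
    1 ≤ bel n D U e ∧ bel n D U e ≤ n := by
  obtain ⟨a, b⟩ := e
  have h0 : 0 ∉ U := fun h => by have := bounds_of_mem_upper hUD h; omega
  have h2 : n + 2 ∉ U := fun h => by have := bounds_of_mem_upper hUD h; omega
  have ha := fun h => bounds_of_mem_upper hUD (v := a) h
  have hb' := fun h => bounds_of_mem_upper hUD (v := b) h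
  obtain ⟨⟨hab, hb⟩, h⟩ := h
  simp only at hab hb
  rw [isBoundaryEdge_iff hUD hdisj] at h
  push Not at h
  obtain ⟨⟨v, hv, hv'⟩, ⟨w, hw, hw'⟩⟩ := h ⟨hab, hb⟩
  have hsub : Bel n D U (a, b) ⊆ Finset.Icc 1 (n + 1) := Finset.filter_subset _ _
  constructor
  · apply Finset.card_pos.2
    have : v ∈ Bel n D U (a, b) ∨ a ∈ Bel n D U (a, b) ∨ b ∈ Bel n D U (a, b) := by
      simp only [mem_Bel hUD hdisj hab hb]
      grind (splits := 40) [Below]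
    rcases this with h | h | h <;> exact ⟨_, h⟩
  · have : (w ∉ Bel n D U (a, b) ∧ 1 ≤ w ∧ w ≤ n + 1) ∨
        (a ∉ Bel n D U (a, b) ∧ 1 ≤ a ∧ a ≤ n + 1) ∨
        (b ∉ Bel n D U (a, b) ∧ 1 ≤ b ∧ b ≤ n + 1) := by
      simp only [mem_Bel hUD hdisj hab hb]
      grind (splits := 40) [Below, Above]
    have fin : ∀ x, x ∉ Bel n D U (a, b) ∧ 1 ≤ x ∧ x ≤ n + 1 → bel n D U (a, b) ≤ n := by
      intro x hx
      have : (Bel n D U (a, b)).card < (Finset.Icc 1 (n + 1)).card :=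
        Finset.card_lt_card ((Finset.ssubset_iff_of_subset hsub).2
          ⟨x, Finset.mem_Icc.2 hx.2, hx.1⟩)
      rw [Nat.card_Icc] at this
      unfold bel
      omega
    rcases this with h | h | h <;> exact fin _ h

/-- The difference between the value on `Bel e` of the constant vector `(n + 2) / 2` and the
right-hand side of the inequality of `e`. -/
def defect (n : ℕ) (D U : Finset ℕ) (e : ℕ × ℕ) : ℝ :=
  (bel n D U e : ℝ) * (n + 1 - bel n D U e) / 2

theorem defect_of_isBoundaryEdge {n : ℕ} {D U : Finset ℕ}
    (hUD : D ∪ U = Finset.Icc 1 (n + 1)) (hdisj : Disjoint D U) {e : ℕ × ℕ}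
    (h : IsBoundaryEdge n D U e) : defect n D U e = 0 := by
  unfold defect bel
  rcases Bel_of_isBoundaryEdge hUD hdisj h with h | h <;> simp [h]

/-- The increment of the coordinate `j` over the center for the triangle `{i,j,k}`. -/
def triangleValue (n : ℕ) (D U : Finset ℕ) (i j k : ℕ) : ℝ :=
  labelSign U j * (defect n D U (i, j) + defect n D U (j, k) - defect n D U (i, k))

theorem triangleValue_lower {n : ℕ} {D U : Finset ℕ} (hUD : D ∪ U = Finset.Icc 1 (n + 1))
    (hdisj : Disjoint D U) {i j k : ℕ} (hjD : j ∈ D) (hij : i < j) (hjk : j < k)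
    (hk : k ≤ n + 2) : triangleValue n D U i j k
      = ((bel n D U (i, j) : ℝ) + 1) * (bel n D U (j, k) + 1) - (n + 2) / 2 := by
  rw [triangleValue, labelSign, if_neg fun h => Finset.disjoint_left.1 hdisj hjD h, defect,
    defect, defect, bel_lower hUD hdisj hjD hij hjk hk]
  ring

theorem triangleValue_upper {n : ℕ} {D U : Finset ℕ} (hUD : D ∪ U = Finset.Icc 1 (n + 1))
    (hdisj : Disjoint D U) {i j k : ℕ} (hjU : j ∈ U) (hij : i < j) (hjk : j < k)
    (hk : k ≤ n + 2) : triangleValue n D U i j k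
      = (n + 2) / 2 - ((n : ℝ) + 2 - bel n D U (i, j)) * (n + 2 - bel n D U (j, k)) := by
  have h := bel_upper hUD hdisj hjU hij hjk hk
  have h' : (bel n D U (i, k) : ℝ) = bel n D U (i, j) + bel n D U (j, k) - n - 2 := by linarith
  rw [triangleValue, labelSign, if_pos hjU, defect, defect, defect, h']
  ring

theorem xcoord_eq {n : ℕ} {D U : Finset ℕ} (hUD : D ∪ U = Finset.Icc 1 (n + 1))
    (hdisj : Disjoint D U) {T : Finset (ℕ × ℕ)} (hT : IsTriangulation n D U T) {i j k : ℕ}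
    (h : IsTriangleOf n D U T i j k) :
    xcoord n D U T j = triangleValue n D U i j k + (n + 2) / 2 := by
  have hex : ∃ p : ℕ × ℕ, IsTriangleOf n D U T p.1 j p.2 := ⟨(i, k), h⟩
  obtain ⟨e1, e2⟩ := triangle_unique hUD hdisj hT hex.choose_spec h
  obtain ⟨h1, h2, h3, -⟩ := h
  rw [xcoord, dif_pos hex, e1, e2]
  rcases mem_lower_or_mem_upper hUD (j := j) ⟨by omega, by omega⟩ with hjD | hjU
  · rw [if_pos hjD, triangleValue_lower hUD hdisj hjD h1 h2 h3]
    ring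
  · rw [if_neg fun h => Finset.disjoint_left.1 hdisj h hjU,
      triangleValue_upper hUD hdisj hjU h1 h2 h3]
    ring

theorem xcoord_eq_zero {n : ℕ} {D U : Finset ℕ} {T : Finset (ℕ × ℕ)} {j : ℕ}
    (hj : j ∉ Finset.Icc 1 (n + 1)) : xcoord n D U T j = 0 := by
  rw [xcoord, dif_neg]
  rintro ⟨p, h1, h2, h3, -⟩
  exact hj (Finset.mem_Icc.2 ⟨by omega, by omega⟩)

theorem Nbr.bel_le {n : ℕ} {D U S S' : Finset ℕ} (hUD : D ∪ U = Finset.Icc 1 (n + 1))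
    (hdisj : Disjoint D U) (hS : S ⊆ S') {j i k i' k' : ℕ} (h : Nbr n D U S j i k)
    (h' : Nbr n D U S' j i' k') (hj : 1 ≤ j ∧ j ≤ n + 1) :
    bel n D U (i, j) ≤ bel n D U (i', j) ∧ bel n D U (j, k) ≤ bel n D U (j, k') := by
  obtain ⟨a1, a2, a3, a4, a5⟩ := h
  obtain ⟨b1, b2, b3, b4, b5⟩ := h'
  have hk := mem_pathVerts_le hUD a2
  have hk' := mem_pathVerts_le hUD b2
  have hU : ∀ u ∈ U, 1 ≤ u ∧ u ≤ n + 1 := fun u hu => bounds_of_mem_upper hUD hu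
  have hiU : i ∈ U → i ∈ pathVerts n D U S' := by
    have := hU i
    rw [mem_pathVerts] at a1 ⊢
    have : i ∈ D → i ∉ U := fun h => Finset.disjoint_left.1 hdisj h
    have := @hS i
    grind
  have hkU : k ∈ U → k ∈ pathVerts n D U S' := by
    have := hU k
    rw [mem_pathVerts] at a2 ⊢
    have : k ∈ D → k ∉ U := fun h => Finset.disjoint_left.1 hdisj h
    have := @hS k
    grind
  have hiD : i' ∉ U → i' ∈ pathVerts n D U S := by
    rw [mem_pathVerts] at b1 ⊢
    have := @hS i'
    grind
  have hkD : k' ∉ U → k' ∈ pathVerts n D U S := by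
    rw [mem_pathVerts] at b2 ⊢
    have := @hS k'
    grind
  have c1 : i ∈ U → i ≤ i' := by
    intro h
    by_contra hlt
    have := b5 i (hiU h) (by omega) (by omega)
    omega
  have c2 : i' ∉ U → i' ≤ i := by
    intro h
    by_contra hlt
    have := a5 i' (hiD h) (by omega) (by omega)
    omega
  have c3 : k ∈ U → k' ≤ k := by
    intro h
    by_contra hlt
    have := b5 k (hkU h) (by omega) (by omega)
    omega
  have c4 : k' ∉ U → k ≤ k' := by
    intro h
    by_contra hlt
    have := a5 k' (hkD h) (by omega) (by omega)
    omega
  clear hiU hkU hiD hkD a5 b5 a1 a2 b1 b2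
  constructor
  · refine Finset.card_le_card fun l => ?_
    rw [mem_Bel hUD hdisj a3 (by omega), mem_Bel hUD hdisj b3 (by omega)]
    grind (splits := 40) [Below]
  · refine Finset.card_le_card fun l => ?_
    rw [mem_Bel hUD hdisj a4 (by omega), mem_Bel hUD hdisj b4 (by omega)]
    grind (splits := 40) [Below]

theorem bel_le_card {n : ℕ} {D U : Finset ℕ} (e : ℕ × ℕ) : bel n D U e ≤ n + 1 := by
  have : Bel n D U e ⊆ Finset.Icc 1 (n + 1) := Finset.filter_subset _ _
  simpa [bel] using Finset.card_le_card this

theorem Nbr.triangleValue_le {n : ℕ} {D U S S' : Finset ℕ}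
    (hUD : D ∪ U = Finset.Icc 1 (n + 1)) (hdisj : Disjoint D U) (hS : S ⊆ S')
    {j i k i' k' : ℕ} (h : Nbr n D U S j i k) (h' : Nbr n D U S' j i' k')
    (hj : 1 ≤ j ∧ j ≤ n + 1) : triangleValue n D U i j k ≤ triangleValue n D U i' j k' := by
  obtain ⟨p1, p2⟩ := h.bel_le hUD hdisj hS h' hj
  have hk := mem_pathVerts_le hUD h.right_mem
  have hk' := mem_pathVerts_le hUD h'.right_mem
  have q1 : (bel n D U (i, j) : ℝ) ≤ bel n D U (i', j) := by exact_mod_cast p1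
  have q2 : (bel n D U (j, k) : ℝ) ≤ bel n D U (j, k') := by exact_mod_cast p2
  rcases mem_lower_or_mem_upper hUD hj with hjD | hjU
  · rw [triangleValue_lower hUD hdisj hjD h.left_lt h.lt_right hk,
      triangleValue_lower hUD hdisj hjD h'.left_lt h'.lt_right hk']
    gcongr
  · rw [triangleValue_upper hUD hdisj hjU h.left_lt h.lt_right hk,
      triangleValue_upper hUD hdisj hjU h'.left_lt h'.lt_right hk']
    have r1 : (bel n D U (i', j) : ℝ) ≤ n + 1 := by exact_mod_cast bel_le_card (i', j)
    have r2 : (bel n D U (j, k) : ℝ) ≤ n + 1 := by exact_mod_cast bel_le_card (j, k)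
    have r3 : (bel n D U (j, k') : ℝ) ≤ n + 1 := by exact_mod_cast bel_le_card (j, k')
    have : ((n : ℝ) + 2 - bel n D U (i', j)) * (n + 2 - bel n D U (j, k'))
        ≤ ((n : ℝ) + 2 - bel n D U (i, j)) * (n + 2 - bel n D U (j, k)) :=
      mul_le_mul (by linarith) (by linarith) (by linarith) (by linarith)
    linarith

/-- The lower bound for the centered sum over `S` of a point of the associahedron. -/
def lowerBound (n : ℕ) (D U S : Finset ℕ) : ℝ := - pathSum n D U (defect n D U) S

theorem lowerBound_insert {n : ℕ} {D U S : Finset ℕ} (hUD : D ∪ U = Finset.Icc 1 (n + 1))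
    (hdisj : Disjoint D U) {j i k : ℕ} (hj : 1 ≤ j ∧ j ≤ n + 1) (h : Nbr n D U S j i k)
    (hjS : j ∉ S) :
    lowerBound n D U (insert j S) = lowerBound n D U S + triangleValue n D U i j k := by
  rw [lowerBound, pathSum_insert hUD hdisj hj h hjS, lowerBound, triangleValue]
  ring

theorem isBoundaryEdge_of_mem_empty {n : ℕ} {D U : Finset ℕ}
    (hUD : D ∪ U = Finset.Icc 1 (n + 1)) (hdisj : Disjoint D U) {e : ℕ × ℕ}
    (he : e ∈ consecPairs (pathVerts n D U ∅)) :
    IsBoundaryEdge n D U e ∧ Bel n D U e = ∅ := by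
  obtain ⟨a, b⟩ := e
  obtain ⟨⟨ha, hb⟩, hab, h⟩ := mem_consecPairs.1 he
  have hb' := mem_pathVerts_le hUD hb
  have hU : ∀ u ∈ U, 1 ≤ u ∧ u ≤ n + 1 := fun u hu => bounds_of_mem_upper hUD hu
  have hD := mem_lower_iff hUD hdisj
  have haU : a ∉ U := by
    rw [mem_pathVerts] at ha; grind
  have hbU : b ∉ U := by
    rw [mem_pathVerts] at hb; grind
  have hB : ∀ v ≤ n + 2, ¬ Below U a b v := by
    intro v hv
    have h1 := h v
    rw [mem_pathVerts, hD] at h1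
    grind [Below]
  refine ⟨(isBoundaryEdge_iff hUD hdisj).2 ⟨⟨hab, hb'⟩, Or.inl hB⟩, ?_⟩
  rw [Finset.eq_empty_iff_forall_notMem]
  intro l
  rw [mem_Bel hUD hdisj hab hb']
  rintro ⟨h1, h2 | h2⟩
  · exact hB l (by omega) h2
  · grind

theorem pathSum_empty {n : ℕ} {D U : Finset ℕ} (hUD : D ∪ U = Finset.Icc 1 (n + 1))
    (hdisj : Disjoint D U) {G : ℕ × ℕ → ℝ} (hG : ∀ e, Bel n D U e = ∅ → G e = 0) :
    pathSum n D U G ∅ = 0 :=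
  Finset.sum_eq_zero fun e he => hG e (isBoundaryEdge_of_mem_empty hUD hdisj he).2

theorem lowerBound_empty {n : ℕ} {D U : Finset ℕ} (hUD : D ∪ U = Finset.Icc 1 (n + 1))
    (hdisj : Disjoint D U) : lowerBound n D U ∅ = 0 := by
  rw [lowerBound, pathSum_empty hUD hdisj, neg_zero]
  intro e he
  simp [defect, bel, he]

theorem lowerBound_full {n : ℕ} {D U : Finset ℕ} (hUD : D ∪ U = Finset.Icc 1 (n + 1))
    (hdisj : Disjoint D U) : lowerBound n D U (Finset.Icc 1 (n + 1)) = 0 := by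
  rw [lowerBound, pathSum, Finset.sum_eq_zero, neg_zero]
  rintro ⟨a, b⟩ he
  obtain ⟨⟨ha, hb⟩, hab, h⟩ := mem_consecPairs.1 he
  have hb' := mem_pathVerts_le hUD hb
  have hU : ∀ u ∈ U, 1 ≤ u ∧ u ≤ n + 1 := fun u hu => bounds_of_mem_upper hUD hu
  have hD := mem_lower_iff hUD hdisj
  refine defect_of_isBoundaryEdge hUD hdisj ((isBoundaryEdge_iff hUD hdisj).2
    ⟨⟨hab, hb'⟩, Or.inr fun v hv => ?_⟩)
  have h1 := h v
  rw [mem_pathVerts, Finset.mem_Icc, hD] at h1 ha hb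
  have := hU v
  grind [Above]

theorem pathSum_sum_Bel {n : ℕ} {D U : Finset ℕ} (hUD : D ∪ U = Finset.Icc 1 (n + 1))
    (hdisj : Disjoint D U) {z : ℕ → ℝ} (hz : ∑ l ∈ Finset.Icc 1 (n + 1), z l = 0)
    {S : Finset ℕ} (hS : S ⊆ Finset.Icc 1 (n + 1)) :
    pathSum n D U (fun e => ∑ l ∈ Bel n D U e, z l) S = ∑ l ∈ S, z l := by
  induction S using Finset.induction_on with
  | empty =>
    rw [pathSum_empty hUD hdisj, Finset.sum_empty]
    intro e he
    simp [he]
  | insert j S hj ih =>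
    have hj' := Finset.mem_Icc.1 (hS (Finset.mem_insert_self j S))
    obtain ⟨i, k, h⟩ := exists_nbr (D := D) (U := U) S hj'
    rw [pathSum_insert hUD hdisj hj' h hj, ih ((Finset.subset_insert j S).trans hS),
      Finset.sum_insert hj, eq_labelSign_mul_sum_Bel hUD hdisj h.left_lt h.lt_right
        (mem_pathVerts_le hUD h.right_mem) hz]
    ring

theorem mem_pathVerts_Bel {n : ℕ} {D U : Finset ℕ} (hUD : D ∪ U = Finset.Icc 1 (n + 1))
    (hdisj : Disjoint D U) {a b : ℕ} (hab : a < b) (hb : b ≤ n + 2) (v : ℕ) :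
    v ∈ pathVerts n D U (Bel n D U (a, b)) ↔ v = 0 ∨ v = n + 2 ∨
      (v ∉ U ∧ v ≤ n + 1 ∧ ¬ Below U a b v) ∨ (v ∈ U ∧ (Below U a b v ∨ v = a ∨ v = b)) := by
  have hU : v ∈ U → 1 ≤ v ∧ v ≤ n + 1 := fun hu => bounds_of_mem_upper hUD hu
  have hD := mem_lower_iff hUD hdisj v
  rw [mem_pathVerts, mem_Bel hUD hdisj hab hb, hD]
  rcases Nat.eq_zero_or_pos v with h0 | h0
  · simp [h0]
  · by_cases hv : v ∈ U
    · have := hU hv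
      tauto
    · tauto

theorem isBoundaryEdge_of_mem_Bel {n : ℕ} {D U : Finset ℕ}
    (hUD : D ∪ U = Finset.Icc 1 (n + 1)) (hdisj : Disjoint D U) {a b : ℕ} (hab : a < b)
    (hb : b ≤ n + 2) {c d : ℕ} (he : (c, d) ∈ consecPairs (pathVerts n D U (Bel n D U (a, b))))
    (hside : d ≤ a ∨ b ≤ c) : IsBoundaryEdge n D U (c, d) := by
  obtain ⟨⟨hc, hd⟩, hcd, h⟩ := mem_consecPairs.1 he
  have hd' := mem_pathVerts_le hUD hd
  have hU : ∀ u ∈ U, 1 ≤ u ∧ u ≤ n + 1 := fun u hu => bounds_of_mem_upper hUD hu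
  refine (isBoundaryEdge_iff hUD hdisj).2 ⟨⟨hcd, hd'⟩, ?_⟩
  have hUc := hU c
  have hUd := hU d
  have hUa := hU a
  have hUb := hU b
  simp only [mem_pathVerts_Bel hUD hdisj hab hb] at hc hd h
  clear he
  have hs : (a ∉ U ∧ d ≤ a) ∨ (b ∉ U ∧ b ≤ c) ∨ (a ∈ U ∧ d ≤ a) ∨ (b ∈ U ∧ b ≤ c) := by
    clear h hc hd hUa hUb hUc hUd hU
    by_cases haU : a ∈ U <;> by_cases hbU : b ∈ U <;> simp [haU, hbU] <;> omega
  clear hside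
  rcases hs with hs | hs | hs | hs
  · left
    have c1 : c ∉ U := by
      clear h hd hUd hUb hUa hUc
      grind [Below]
    have d1 : d ∉ U := by
      clear h hc hUc hUb hUa hUd
      grind [Below]
    clear hc hd
    intro v hv hB
    have h := h v
    have hUv := hU v
    clear hU
    have key : v ∉ U ∧ c < v ∧ v < d := by
      clear h
      grind [Below, Above]
    clear hB
    grind [Below]
  · left
    have c1 : c ∉ U := by
      clear h hd hUd hUb hUa hUc
      grind [Below]
    have d1 : d ∉ U := by
      clear h hc hUc hUb hUa hUd
      grind [Below]
    clear hc hd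
    intro v hv hB
    have h := h v
    have hUv := hU v
    clear hU
    have key : v ∉ U ∧ c < v ∧ v < d := by
      clear h
      grind [Below, Above]
    clear hB
    grind [Below]
  · right
    have c1 : c ∈ U ∨ c = 0 := by
      clear h hd hUd hUb hUa hUc
      grind [Below]
    have d1 : d ∈ U := by
      clear h hc hUc hUb hUa hUd
      grind [Below]
    clear hc hd
    intro v hv hB
    have h := h v
    have hUv := hU v
    clear hU
    have key : v ∈ U ∧ c < v ∧ v < d := by
      clear h
      grind [Below, Above]
    clear hB
    grind [Below]
  · right
    have c1 : c ∈ U := by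
      clear h hd hUd hUb hUa hUc
      grind [Below]
    have d1 : d ∈ U ∨ d = n + 2 := by
      clear h hc hUc hUb hUa hUd
      grind [Below]
    clear hc hd
    intro v hv hB
    have h := h v
    have hUv := hU v
    clear hU
    have key : v ∈ U ∧ c < v ∧ v < d := by
      clear h
      grind [Below, Above]
    clear hB
    grind [Below]

theorem lowerBound_Bel {n : ℕ} {D U : Finset ℕ} (hUD : D ∪ U = Finset.Icc 1 (n + 1))
    (hdisj : Disjoint D U) {a b : ℕ} (hab : a < b) (hb : b ≤ n + 2) :
    lowerBound n D U (Bel n D U (a, b)) = - defect n D U (a, b) := by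
  have hV := mem_pathVerts_Bel hUD hdisj hab hb
  have ha : a ∈ pathVerts n D U (Bel n D U (a, b)) := by
    rw [hV]
    grind [Below]
  have hb' : b ∈ pathVerts n D U (Bel n D U (a, b)) := by
    rw [hV]
    grind [Below]
  have hnm : ∀ v ∈ pathVerts n D U (Bel n D U (a, b)), ¬ (a < v ∧ v < b) := by
    intro v hv
    rw [hV] at hv
    grind [Below]
  rw [lowerBound, pathSum, Finset.sum_eq_single_of_mem (a, b)]
  · exact mem_consecPairs.2 ⟨⟨ha, hb'⟩, hab, hnm⟩
  · rintro ⟨c, d⟩ he hne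
    obtain ⟨⟨hc, hd⟩, hcd, h⟩ := mem_consecPairs.1 he
    refine defect_of_isBoundaryEdge hUD hdisj (isBoundaryEdge_of_mem_Bel hUD hdisj hab hb he ?_)
    by_contra hcon
    have := hnm c hc
    have := hnm d hd
    have := h a ha
    have := h b hb'
    exact hne (by rw [Prod.mk.injEq]; omega)

theorem not_cross_of_mem_paths {n : ℕ} {D U S S' : Finset ℕ}
    (hUD : D ∪ U = Finset.Icc 1 (n + 1)) (hdisj : Disjoint D U) (hS : S ⊆ S') {e e' : ℕ × ℕ}
    (he : e ∈ consecPairs (pathVerts n D U S)) (he' : e' ∈ consecPairs (pathVerts n D U S')) :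
    ¬ Cross n D U e e' := by
  obtain ⟨a, b⟩ := e
  obtain ⟨c, d⟩ := e'
  obtain ⟨⟨ha, hb⟩, hab, h⟩ := mem_consecPairs.1 he
  obtain ⟨⟨hc, hd⟩, hcd, h'⟩ := mem_consecPairs.1 he'
  rw [cross_iff hUD hdisj hab (mem_pathVerts_le hUD hb) hcd (mem_pathVerts_le hUD hd)]
  have hU : ∀ u ∈ U, 1 ≤ u ∧ u ≤ n + 1 := fun u hu => bounds_of_mem_upper hUD hu
  have hD := mem_lower_iff hUD hdisj
  have up : ∀ v ∈ pathVerts n D U S, v ∈ U → v ∈ pathVerts n D U S' := by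
    intro v hv hvU
    have := hU v hvU
    have := @hS v
    rw [mem_pathVerts, hD] at hv ⊢
    grind
  have low : ∀ v ∈ pathVerts n D U S', v ∉ U → v ∈ pathVerts n D U S := by
    intro v hv hvU
    have := @hS v
    rw [mem_pathVerts] at hv ⊢
    grind
  have a1 := up a ha
  have b1 := up b hb
  have c1 := low c hc
  have d1 := low d hd
  have h1 := h c
  have h2 := h d
  have h3 := h' a
  have h4 := h' b
  clear h h' up low he he' hc hd
  grind (splits := 40) [Below, Above]

/-- Every edge of the path of `S` is a diagonal of `T` or a boundary edge. -/
def ContainsPath (n : ℕ) (D U : Finset ℕ) (T : Finset (ℕ × ℕ)) (S : Finset ℕ) : Prop :=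
  ∀ e ∈ consecPairs (pathVerts n D U S), EdgeOf n D U T e.1 e.2

theorem containsPath_empty {n : ℕ} {D U : Finset ℕ} (hUD : D ∪ U = Finset.Icc 1 (n + 1))
    (hdisj : Disjoint D U) (T : Finset (ℕ × ℕ)) : ContainsPath n D U T ∅ :=
  fun _ he => Or.inr (isBoundaryEdge_of_mem_empty hUD hdisj he).1

theorem Nbr.mem_consecPairs_lower {n : ℕ} {D U S : Finset ℕ} {j i k : ℕ} (h : Nbr n D U S j i k) (hjS : j ∉ S) (hjD : j ∈ D) :
    (i, j) ∈ consecPairs (pathVerts n D U S) ∧ (j, k) ∈ consecPairs (pathVerts n D U S) := by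
  have hj : j ∈ pathVerts n D U S := mem_pathVerts.2 (Or.inr (Or.inr (Or.inl ⟨hjD, hjS⟩)))
  obtain ⟨h1, h2, h3, h4, h5⟩ := h
  refine ⟨mem_consecPairs.2 ⟨⟨h1, hj⟩, h3, fun v hv hvv => ?_⟩,
    mem_consecPairs.2 ⟨⟨hj, h2⟩, h4, fun v hv hvv => ?_⟩⟩
  all_goals
    have := h5 v hv (by omega) (by omega)
    omega

theorem Nbr.mem_consecPairs_upper {n : ℕ} {D U S : Finset ℕ}
    (hUD : D ∪ U = Finset.Icc 1 (n + 1)) (hdisj : Disjoint D U)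
    {j i k : ℕ} (h : Nbr n D U S j i k) (hjS : j ∉ S) (hjU : j ∈ U) :
    (i, k) ∈ consecPairs (pathVerts n D U S) :=
  mem_consecPairs.2 ⟨⟨h.left_mem, h.right_mem⟩, h.left_lt.trans h.lt_right,
    (h.upper_facts hUD hdisj hjS hjU).2⟩

theorem Nbr.consecPairs_insert_upper {n : ℕ} {D U S : Finset ℕ}
    (hUD : D ∪ U = Finset.Icc 1 (n + 1)) (hdisj : Disjoint D U)
    {j i k : ℕ} (h : Nbr n D U S j i k) (hjS : j ∉ S) (hjU : j ∈ U) :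
    consecPairs (pathVerts n D U (insert j S))
      = insert (i, j) (insert (j, k) ((consecPairs (pathVerts n D U S)).erase (i, k))) := by
  obtain ⟨h1, h2⟩ := h.upper_facts hUD hdisj hjS hjU
  rw [pathVerts_insert_upper hdisj hjU,
    consecPairs_insert h1 h.left_mem h.right_mem h.left_lt h.lt_right h2]

theorem Nbr.consecPairs_eq_lower {n : ℕ} {D U S : Finset ℕ}
    (hUD : D ∪ U = Finset.Icc 1 (n + 1)) (hdisj : Disjoint D U)
    {j i k : ℕ} (h : Nbr n D U S j i k) (hjS : j ∉ S) (hjD : j ∈ D) :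
    consecPairs (pathVerts n D U S) = insert (i, j) (insert (j, k)
      ((consecPairs (pathVerts n D U (insert j S))).erase (i, k))) := by
  obtain ⟨h1, h2, h3, h4⟩ := h.lower_facts hUD hdisj hjS hjD
  rw [pathVerts_insert_lower hdisj hjD hjS,
    consecPairs_insert h1 h2 h3 h.left_lt h.lt_right h4]

theorem ContainsPath.isTriangleOf {n : ℕ} {D U : Finset ℕ} {T : Finset (ℕ × ℕ)} {S : Finset ℕ}
    (hUD : D ∪ U = Finset.Icc 1 (n + 1)) (hdisj : Disjoint D U)
    {j i k : ℕ} (hj : 1 ≤ j ∧ j ≤ n + 1) (hjS : j ∉ S) (h : Nbr n D U S j i k)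
    (hS : ContainsPath n D U T S) (hS' : ContainsPath n D U T (insert j S)) :
    IsTriangleOf n D U T i j k := by
  refine ⟨h.left_lt, h.lt_right, mem_pathVerts_le hUD h.right_mem, ?_⟩
  rcases mem_lower_or_mem_upper hUD hj with hjD | hjU
  · obtain ⟨e1, e2⟩ := h.mem_consecPairs_lower hjS hjD
    obtain ⟨-, h2, h3, h4⟩ := h.lower_facts hUD hdisj hjS hjD
    exact ⟨hS _ e1, hS _ e2, hS' _ (mem_consecPairs.2
      ⟨⟨h2, h3⟩, h.left_lt.trans h.lt_right, h4⟩)⟩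
  · have e := h.consecPairs_insert_upper hUD hdisj hjS hjU
    exact ⟨hS' (i, j) (by simp [e]), hS' (j, k) (by simp [e]),
      hS _ (h.mem_consecPairs_upper hUD hdisj hjS hjU)⟩

theorem ContainsPath.insert_upper {n : ℕ} {D U : Finset ℕ} {T : Finset (ℕ × ℕ)} {S : Finset ℕ}
    (hUD : D ∪ U = Finset.Icc 1 (n + 1)) (hdisj : Disjoint D U)
    {j i k : ℕ} (hjU : j ∈ U) (hjS : j ∉ S) (h : Nbr n D U S j i k)
    (hS : ContainsPath n D U T S) (h1 : EdgeOf n D U T i j) (h2 : EdgeOf n D U T j k) :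
    ContainsPath n D U T (insert j S) := by
  intro e he
  rw [h.consecPairs_insert_upper hUD hdisj hjS hjU, Finset.mem_insert, Finset.mem_insert] at he
  rcases he with rfl | rfl | he
  · exact h1
  · exact h2
  · exact hS e (Finset.mem_of_mem_erase he)

theorem ContainsPath.insert_lower {n : ℕ} {D U : Finset ℕ} {T : Finset (ℕ × ℕ)} {S : Finset ℕ}
    (hUD : D ∪ U = Finset.Icc 1 (n + 1)) (hdisj : Disjoint D U)
    {j i k : ℕ} (hjD : j ∈ D) (hjS : j ∉ S) (h : Nbr n D U S j i k)
    (hS : ContainsPath n D U T S) (h1 : EdgeOf n D U T i k) :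
    ContainsPath n D U T (insert j S) := by
  intro e he
  by_cases hne : e = (i, k)
  · rw [hne]
    exact h1
  · refine hS e ?_
    rw [h.consecPairs_eq_lower hUD hdisj hjS hjD]
    simp [he, hne]

theorem ContainsPath.exists_insert {n : ℕ} {D U : Finset ℕ} {T : Finset (ℕ × ℕ)}
    {S : Finset ℕ} (hUD : D ∪ U = Finset.Icc 1 (n + 1)) (hdisj : Disjoint D U)
    (hT : IsTriangulation n D U T) (hS : ContainsPath n D U T S) {j₀ : ℕ}
    (hj₀ : 1 ≤ j₀ ∧ j₀ ≤ n + 1) (hj₀S : j₀ ∉ S) :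
    ∃ j, (1 ≤ j ∧ j ≤ n + 1) ∧ j ∉ S ∧ ContainsPath n D U T (insert j S) := by
  have hU : ∀ u ∈ U, 1 ≤ u ∧ u ≤ n + 1 := fun u hu => bounds_of_mem_upper hUD hu
  have hD := mem_lower_iff hUD hdisj
  have h0 : 0 ∉ U := fun h => by have := hU _ h; omega
  have hn2 : n + 2 ∉ U := fun h => by have := hU _ h; omega
  have hpath : ∀ v ∈ pathVerts n D U S, 1 ≤ v → v ≤ n + 1 → v ∉ U → v ∈ D ∧ v ∉ S := by
    intro v hv h1 h2 h3
    rw [mem_pathVerts] at hv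
    rcases hv with h | h | h | h
    · omega
    · omega
    · exact h
    · exact absurd h.1 h3
  set L := (consecPairs (pathVerts n D U S)).filter fun e => ∃ c ≤ n + 2, Above U e.1 e.2 c ∧
    Link n D U T e.1 c ∧ Link n D U T e.2 c ∧ c < e.2 with hL
  rcases L.eq_empty_or_nonempty with hLe | hLne
  · exfalso
    set M := (consecPairs (pathVerts n D U S)).filter fun e => ∃ v ≤ n + 2, Above U e.1 e.2 v
      with hM
    have hMne : M.Nonempty := by
      obtain ⟨i, k, h⟩ := exists_nbr (D := D) (U := U) S hj₀
      rcases mem_lower_or_mem_upper hUD hj₀ with hjD | hjU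
      · refine ⟨(i, j₀), Finset.mem_filter.2 ⟨(h.mem_consecPairs_lower hj₀S hjD).1,
          n + 2, le_rfl, Or.inr ⟨hn2, Or.inr ⟨((hD j₀).1 hjD).2, by dsimp only; omega⟩⟩⟩⟩
      · exact ⟨(i, k), Finset.mem_filter.2 ⟨h.mem_consecPairs_upper hUD hdisj hj₀S hjU,
          j₀, by omega, Or.inl ⟨hjU, Or.inr h.left_lt, Or.inr h.lt_right⟩⟩⟩
    obtain ⟨⟨a, b⟩, he, hmax⟩ := M.exists_max_image Prod.fst hMne
    obtain ⟨he1, hv⟩ := Finset.mem_filter.1 he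
    obtain ⟨⟨ha, hb⟩, hab, -⟩ := mem_consecPairs.1 he1
    obtain ⟨c, hc, hA, hl1, hl2⟩ := exists_apex_above hUD hdisj hT (hS _ he1) hv
    have hcb : ¬ c < b := fun hcb => by
      have : (a, b) ∈ L := Finset.mem_filter.2 ⟨he1, c, hc, hA, hl1, hl2, hcb⟩
      simp [hLe] at this
    have hbU : b ∉ U ∧ b < c := by grind [Above]
    obtain ⟨hbD, hbS⟩ := hpath b hb (by omega) (by omega) hbU.1
    obtain ⟨i, k, h⟩ := exists_nbr (n := n) (D := D) (U := U) (j := b) S ⟨by omega, by omega⟩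
    have := hmax (b, k) (Finset.mem_filter.2 ⟨(h.mem_consecPairs_lower hbS hbD).2,
      0, by omega, Or.inr ⟨h0, Or.inl ⟨hbU.1, by dsimp only; omega⟩⟩⟩)
    dsimp only at this
    omega
  · obtain ⟨⟨a, b⟩, he, hmin⟩ := L.exists_min_image Prod.fst hLne
    obtain ⟨he1, c, hc, hA, hl1, hl2, hcb⟩ := Finset.mem_filter.1 he
    obtain ⟨⟨ha, hb⟩, hab, hcons⟩ := mem_consecPairs.1 he1
    have hb' := mem_pathVerts_le hUD hb
    dsimp only at hA hl1 hl2 hcb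
    have hca : c ≠ a := by grind [Above]
    rcases lt_or_gt_of_ne hca with hca | hca
    · have haU : a ∉ U := by grind [Above]
      obtain ⟨haD, haS⟩ := hpath a ha (by omega) (by omega) haU
      obtain ⟨a', k, h⟩ := exists_nbr (n := n) (D := D) (U := U) (j := a) S ⟨by omega, by omega⟩
      have hk : k = b := by
        have h1 := hcons k h.right_mem
        have h2 := h.eq_of_between b hb (by have := h.left_lt; omega)
        have h3 := h.lt_right
        omega
      subst hk
      have he2 := (h.mem_consecPairs_lower haS haD).1
      obtain ⟨c', hc', hA', hl1', hl2'⟩ := exists_apex_above hUD hdisj hT (hS _ he2)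
        ⟨n + 2, le_rfl, Or.inr ⟨hn2, Or.inr ⟨haU, by dsimp only; omega⟩⟩⟩
      dsimp only at hA' hl1' hl2'
      have ha' := h.left_lt
      have hc'a : ¬ c' < a := fun hlt => by
        have := hmin (a', a) (Finset.mem_filter.2 ⟨he2, c', hc', hA', hl1', hl2', hlt⟩)
        dsimp only at this
        omega
      have hc'ne : c' ≠ a := by grind [Above]
      have hac' : a < c' := by omega
      rw [Link, min_eq_right (by omega), max_eq_left (by omega)] at hl1 hl2
      rw [Link, min_eq_left (by omega), max_eq_right (by omega)] at hl1' hl2'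
      obtain ⟨e1, e2⟩ := triangle_unique hUD hdisj hT
        (⟨hca, hab, hb', hl1, hS _ he1, hl2⟩ : IsTriangleOf n D U T c a k)
        (⟨ha', hac', hc', hS _ he2, hl2', hl1'⟩ : IsTriangleOf n D U T a' a c')
      exact ⟨a, ⟨by omega, by omega⟩, haS, hS.insert_lower hUD hdisj haD haS h (e1 ▸ hl2)⟩
    · have hcU : c ∈ U := by grind [Above]
      have hcS : c ∉ S := fun hcS => hcons c
        (mem_pathVerts.2 (Or.inr (Or.inr (Or.inr ⟨hcU, hcS⟩)))) ⟨hca, hcb⟩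
      have h : Nbr n D U S c a b := ⟨ha, hb, hca, hcb, fun v hv h1 h2 => absurd ⟨h1, h2⟩ (hcons v hv)⟩
      rw [Link, min_eq_left (by omega), max_eq_right (by omega)] at hl1
      rw [Link, min_eq_right (by omega), max_eq_left (by omega)] at hl2
      exact ⟨c, hU c hcU, hcS, hS.insert_upper hUD hdisj hcU hcS h hl1 hl2⟩

/-- The vector `x` centered at the constant vector `(n + 2) / 2`. -/
def centered (n : ℕ) (x : ℕ → ℝ) (j : ℕ) : ℝ := x j - (n + 2) / 2

theorem ContainsPath.centered_xcoord {n : ℕ} {D U : Finset ℕ} {T : Finset (ℕ × ℕ)}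
    {S : Finset ℕ} (hUD : D ∪ U = Finset.Icc 1 (n + 1)) (hdisj : Disjoint D U)
    (hT : IsTriangulation n D U T) (hS : ContainsPath n D U T S) {j i k : ℕ}
    (hj : 1 ≤ j ∧ j ≤ n + 1) (hjS : j ∉ S) (hS' : ContainsPath n D U T (insert j S))
    (h : Nbr n D U S j i k) :
    centered n (xcoord n D U T) j = triangleValue n D U i j k := by
  rw [centered, xcoord_eq hUD hdisj hT (hS.isTriangleOf hUD hdisj hj hjS h hS')]
  ring

theorem ContainsPath.lowerBound_insert {n : ℕ} {D U : Finset ℕ} {T : Finset (ℕ × ℕ)}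
    {S : Finset ℕ} (hUD : D ∪ U = Finset.Icc 1 (n + 1)) (hdisj : Disjoint D U)
    (hT : IsTriangulation n D U T) (hS : ContainsPath n D U T S) {j : ℕ}
    (hj : 1 ≤ j ∧ j ≤ n + 1) (hjS : j ∉ S) (hS' : ContainsPath n D U T (insert j S)) :
    lowerBound n D U (insert j S) = lowerBound n D U S + centered n (xcoord n D U T) j := by
  obtain ⟨i, k, h⟩ := exists_nbr (D := D) (U := U) S hj
  rw [hS.centered_xcoord hUD hdisj hT hj hjS hS' h, Spines.lowerBound_insert hUD hdisj hj h hjS]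

theorem lowerBound_le_sum_of_containsPath {n : ℕ} {D U : Finset ℕ} {T : Finset (ℕ × ℕ)}
    (hUD : D ∪ U = Finset.Icc 1 (n + 1)) (hdisj : Disjoint D U)
    (hT : IsTriangulation n D U T) (m : ℕ) (S : Finset ℕ) (hS : S ⊆ Finset.Icc 1 (n + 1))
    (hm : (Finset.Icc 1 (n + 1) \ S).card = m) (hP : ContainsPath n D U T S)
    (hsum : ∑ j ∈ S, centered n (xcoord n D U T) j = lowerBound n D U S)
    (hle : ∀ R, lowerBound n D U (R ∩ S) ≤ ∑ j ∈ R ∩ S, centered n (xcoord n D U T) j) :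
    ∑ j ∈ Finset.Icc 1 (n + 1), centered n (xcoord n D U T) j = 0 ∧
      ∀ R ⊆ Finset.Icc 1 (n + 1),
        lowerBound n D U R ≤ ∑ j ∈ R, centered n (xcoord n D U T) j := by
  induction m generalizing S with
  | zero =>
    have hSe : S = Finset.Icc 1 (n + 1) :=
      hS.antisymm (Finset.sdiff_eq_empty_iff_subset.1 (Finset.card_eq_zero.1 hm))
    subst hSe
    refine ⟨by rw [hsum, lowerBound_full hUD hdisj], fun R hR => ?_⟩
    simpa [Finset.inter_eq_left.2 hR] using hle R
  | succ m ih =>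
    obtain ⟨j₀, hj₀⟩ := Finset.card_pos.1 (by omega : 0 < (Finset.Icc 1 (n + 1) \ S).card)
    obtain ⟨h1, h2⟩ := Finset.mem_sdiff.1 hj₀
    obtain ⟨j, hj, hjS, hP'⟩ := hP.exists_insert hUD hdisj hT (Finset.mem_Icc.1 h1) h2
    refine ih (insert j S) (Finset.insert_subset (Finset.mem_Icc.2 hj) hS) ?_ hP' ?_ fun R => ?_
    · rw [Finset.sdiff_insert, Finset.card_erase_of_mem
        (Finset.mem_sdiff.2 ⟨Finset.mem_Icc.2 hj, hjS⟩), hm, Nat.add_sub_cancel]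
    · rw [Finset.sum_insert hjS, hsum, hP.lowerBound_insert hUD hdisj hT hj hjS hP', add_comm]
    · by_cases hjR : j ∈ R
      · have hj' : j ∉ R ∩ S := fun h => hjS (Finset.mem_inter.1 h).2
        obtain ⟨i, k, h⟩ := exists_nbr (D := D) (U := U) S hj
        obtain ⟨i', k', h'⟩ := exists_nbr (D := D) (U := U) (R ∩ S) hj
        rw [Finset.inter_insert_of_mem hjR, Finset.sum_insert hj',
          lowerBound_insert hUD hdisj hj h' hj', hP.centered_xcoord hUD hdisj hT hj hjS hP' h]
        have := h'.triangleValue_le hUD hdisj Finset.inter_subset_right h hj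
        have := hle R
        linarith
      · rw [Finset.inter_insert_of_notMem hjR]
        exact hle R

theorem lowerBound_le_sum_xcoord {n : ℕ} {D U : Finset ℕ} {T : Finset (ℕ × ℕ)}
    (hUD : D ∪ U = Finset.Icc 1 (n + 1)) (hdisj : Disjoint D U)
    (hT : IsTriangulation n D U T) :
    ∑ j ∈ Finset.Icc 1 (n + 1), centered n (xcoord n D U T) j = 0 ∧
      ∀ R ⊆ Finset.Icc 1 (n + 1),
        lowerBound n D U R ≤ ∑ j ∈ R, centered n (xcoord n D U T) j := by
  refine lowerBound_le_sum_of_containsPath hUD hdisj hT _ ∅ (Finset.empty_subset _) rfl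
    (containsPath_empty hUD hdisj T) ?_ fun R => ?_ <;>
  simp [lowerBound_empty hUD hdisj]

theorem lowerBound_le_sum {n : ℕ} {D U : Finset ℕ}
    (hUD : D ∪ U = Finset.Icc 1 (n + 1)) (hdisj : Disjoint D U) {z : ℕ → ℝ}
    (hz : ∑ j ∈ Finset.Icc 1 (n + 1), z j = 0)
    (h : ∀ δ, IsInternalDiag n D U δ → - defect n D U δ ≤ ∑ j ∈ Bel n D U δ, z j)
    {S : Finset ℕ} (hS : S ⊆ Finset.Icc 1 (n + 1)) : lowerBound n D U S ≤ ∑ j ∈ S, z j := by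
  rw [← pathSum_sum_Bel hUD hdisj hz hS, lowerBound, pathSum, pathSum, ← Finset.sum_neg_distrib]
  refine Finset.sum_le_sum fun e he => ?_
  by_cases hb : IsBoundaryEdge n D U e
  · rw [defect_of_isBoundaryEdge hUD hdisj hb]
    rcases Bel_of_isBoundaryEdge hUD hdisj hb with h | h <;> simp [h, hz]
  · obtain ⟨⟨-, h2⟩, h3, -⟩ := mem_consecPairs.1 he
    exact h e ⟨⟨h3, mem_pathVerts_le hUD h2⟩, hb⟩

theorem exists_sorted_chain (f : ℕ → ℝ) (A : Finset ℕ) :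
    ∃ C : Finset (Finset ℕ), A ∈ C ∧ (∀ B ∈ C, B ⊆ A) ∧
      (∀ B ∈ C, ∀ B' ∈ C, B ⊆ B' ∨ B' ⊆ B) ∧
      ∀ B ∈ C, B = ∅ ∨ ∃ j, ∃ B' ∈ C, j ∉ B' ∧ B = insert j B' ∧ ∀ i ∈ B', f j ≤ f i := by
  induction A using Finset.induction_on_min_value f with
  | empty => exact ⟨{∅}, by simp⟩
  | insert a s ha hmin ih =>
    obtain ⟨C, h1, h2, h3, h4⟩ := ih
    have h5 : ∀ B ∈ C, B ⊆ insert a s := fun B hB => (h2 B hB).trans (Finset.subset_insert a s)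
    refine ⟨insert (insert a s) C, Finset.mem_insert_self _ _, ?_, ?_, ?_⟩
    · intro B hB
      rcases Finset.mem_insert.1 hB with rfl | hB
      · exact subset_rfl
      · exact h5 B hB
    · intro B hB B' hB'
      rcases Finset.mem_insert.1 hB with rfl | hB
      · rcases Finset.mem_insert.1 hB' with rfl | hB'
        · exact Or.inl subset_rfl
        · exact Or.inr (h5 B' hB')
      · rcases Finset.mem_insert.1 hB' with rfl | hB'
        · exact Or.inl (h5 B hB)
        · exact h3 B hB B' hB'
    · intro B hB
      rcases Finset.mem_insert.1 hB with rfl | hB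
      · exact Or.inr ⟨a, s, Finset.mem_insert_of_mem h1, ha, rfl, hmin⟩
      · rcases h4 B hB with h | ⟨j, B', hB', h⟩
        · exact Or.inl h
        · exact Or.inr ⟨j, B', Finset.mem_insert_of_mem hB', h⟩

theorem exists_triangulation_containsPath {n : ℕ} {D U : Finset ℕ}
    (hUD : D ∪ U = Finset.Icc 1 (n + 1)) (hdisj : Disjoint D U) {C : Finset (Finset ℕ)}
    (hC : ∀ B ∈ C, ∀ B' ∈ C, B ⊆ B' ∨ B' ⊆ B) :
    ∃ T, IsTriangulation n D U T ∧ ∀ B ∈ C, ContainsPath n D U T B := by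
  have hdiag : ∀ B : Finset ℕ, ∀ e ∈ consecPairs (pathVerts n D U B), IsDiag n e := by
    rintro B ⟨a, b⟩ he
    obtain ⟨⟨-, h2⟩, h3, -⟩ := mem_consecPairs.1 he
    exact ⟨h3, mem_pathVerts_le hUD h2⟩
  obtain ⟨T, hT, hsub⟩ := exists_triangulation_supset hUD hdisj
    (T₀ := (C.biUnion fun B => consecPairs (pathVerts n D U B)).filter (IsInternalDiag n D U))
    (fun δ hδ => (Finset.mem_filter.1 hδ).2) (by
      intro δ hδ δ' hδ'
      obtain ⟨B, hB, h⟩ := Finset.mem_biUnion.1 (Finset.mem_filter.1 hδ).1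
      obtain ⟨B', hB', h'⟩ := Finset.mem_biUnion.1 (Finset.mem_filter.1 hδ').1
      rcases hC B hB B' hB' with hBB | hBB
      · exact not_cross_of_mem_paths hUD hdisj hBB h h'
      · rw [cross_comm hUD hdisj (hdiag B δ h).1 (hdiag B δ h).2 (hdiag B' δ' h').1
          (hdiag B' δ' h').2]
        exact not_cross_of_mem_paths hUD hdisj hBB h' h)
  refine ⟨T, hT, fun B hB e he => ?_⟩
  by_cases hb : IsBoundaryEdge n D U e
  · exact Or.inr hb
  · exact Or.inl (hsub (Finset.mem_filter.2
      ⟨Finset.mem_biUnion.2 ⟨B, hB, he⟩, hdiag B e he, hb⟩))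

theorem exists_triangulation_minimizing {n : ℕ} {D U : Finset ℕ}
    (hUD : D ∪ U = Finset.Icc 1 (n + 1)) (hdisj : Disjoint D U) (f : ℕ → ℝ) :
    ∃ T, IsTriangulation n D U T ∧ ∀ z : ℕ → ℝ, ∑ j ∈ Finset.Icc 1 (n + 1), z j = 0 →
      (∀ S ⊆ Finset.Icc 1 (n + 1), lowerBound n D U S ≤ ∑ j ∈ S, z j) →
      ∑ j ∈ Finset.Icc 1 (n + 1), f j * centered n (xcoord n D U T) j
        ≤ ∑ j ∈ Finset.Icc 1 (n + 1), f j * z j := by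
  obtain ⟨C, h1, h2, h3, h4⟩ := exists_sorted_chain f (Finset.Icc 1 (n + 1))
  obtain ⟨T, hT, hP⟩ := exists_triangulation_containsPath hUD hdisj h3
  refine ⟨T, hT, fun z hz hle => ?_⟩
  set w := centered n (xcoord n D U T) with hw
  have hsum : ∀ B ∈ C, ∑ j ∈ B, w j = lowerBound n D U B := by
    intro B
    induction B using Finset.strongInduction with
    | H B ih =>
      intro hB
      rcases h4 B hB with rfl | ⟨j, B', hB', hj, rfl, -⟩
      · rw [Finset.sum_empty, lowerBound_empty hUD hdisj]
      · rw [Finset.sum_insert hj, ih B' (Finset.ssubset_insert hj) hB',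
          (hP B' hB').lowerBound_insert hUD hdisj hT
            (Finset.mem_Icc.1 (h2 _ hB (Finset.mem_insert_self j B'))) hj (hP _ hB), add_comm]
  have hmul : ∀ B ∈ C, ∀ t, (∀ i ∈ B, t ≤ f i) →
      t * ∑ j ∈ B, (z j - w j) ≤ ∑ j ∈ B, f j * (z j - w j) := by
    intro B
    induction B using Finset.strongInduction with
    | H B ih =>
      intro hB t ht
      have hnn : 0 ≤ ∑ j ∈ B, (z j - w j) := by
        rw [Finset.sum_sub_distrib, hsum B hB]
        exact sub_nonneg.2 (hle B (h2 B hB))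
      rcases h4 B hB with rfl | ⟨j, B', hB', hj, rfl, hmin⟩
      · simp
      · have := ih B' (Finset.ssubset_insert hj) hB' (f j) hmin
        have htj := mul_le_mul_of_nonneg_right (ht j (Finset.mem_insert_self j B')) hnn
        rw [Finset.sum_insert hj] at htj ⊢
        rw [Finset.sum_insert hj]
        linarith
  have hfull := hmul _ h1 ((Finset.Icc 1 (n + 1)).inf' ⟨1, by simp⟩ f)
    fun i hi => Finset.inf'_le f hi
  rw [Finset.sum_sub_distrib, hz, hsum _ h1, lowerBound_full hUD hdisj] at hfull
  simp only [mul_sub, Finset.sum_sub_distrib, sub_zero, mul_zero] at hfull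
  linarith

/-- The points `x(T)` of the triangulations. -/
def triangulationPoints (n : ℕ) (D U : Finset ℕ) : Set (ℕ → ℝ) :=
  {x | ∃ T : Finset (ℕ × ℕ), IsTriangulation n D U T ∧ x = xcoord n D U T}

/-- The polytope given by the inequalities of the internal diagonals. -/
def diagonalPolytope (n : ℕ) (D U : Finset ℕ) : Set (ℕ → ℝ) :=
  {x | (∀ j : ℕ, j ∉ Finset.Icc 1 (n + 1) → x j = 0) ∧
    (∑ j ∈ Finset.Icc 1 (n + 1), x j = ((n : ℝ) + 2) * ((n : ℝ) + 1) / 2) ∧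
    (∀ δ : ℕ × ℕ, IsInternalDiag n D U δ →
      ((bel n D U δ : ℝ) + 1) * (bel n D U δ : ℝ) / 2 ≤ ∑ j ∈ Bel n D U δ, x j)}

theorem sum_centered (n : ℕ) (x : ℕ → ℝ) (S : Finset ℕ) :
    ∑ j ∈ S, centered n x j = ∑ j ∈ S, x j - S.card * ((n + 2) / 2) := by
  simp [centered, Finset.sum_sub_distrib]

theorem mem_diagonalPolytope_iff {n : ℕ} {D U : Finset ℕ} {x : ℕ → ℝ} :
    x ∈ diagonalPolytope n D U ↔ (∀ j : ℕ, j ∉ Finset.Icc 1 (n + 1) → x j = 0) ∧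
      ∑ j ∈ Finset.Icc 1 (n + 1), centered n x j = 0 ∧
      ∀ δ, IsInternalDiag n D U δ → - defect n D U δ ≤ ∑ j ∈ Bel n D U δ, centered n x j := by
  refine and_congr_right fun _ => and_congr ?_ (forall₂_congr fun δ _ => ?_)
  · rw [sum_centered, Nat.card_Icc]
    push_cast
    constructor <;> intro h <;> linarith
  · rw [sum_centered, defect, bel]
    constructor <;> intro h <;> linarith

theorem xcoord_mem_diagonalPolytope {n : ℕ} {D U : Finset ℕ} {T : Finset (ℕ × ℕ)}
    (hUD : D ∪ U = Finset.Icc 1 (n + 1)) (hdisj : Disjoint D U)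
    (hT : IsTriangulation n D U T) : xcoord n D U T ∈ diagonalPolytope n D U := by
  obtain ⟨h1, h2⟩ := lowerBound_le_sum_xcoord hUD hdisj hT
  refine mem_diagonalPolytope_iff.2 ⟨fun j hj => xcoord_eq_zero hj, h1, ?_⟩
  rintro ⟨a, b⟩ hδ
  rw [← lowerBound_Bel hUD hdisj hδ.1.1 hδ.1.2]
  exact h2 _ (Finset.filter_subset _ _)

theorem convex_diagonalPolytope (n : ℕ) (D U : Finset ℕ) : Convex ℝ (diagonalPolytope n D U) := by
  rintro x ⟨x1, x2, x3⟩ y ⟨y1, y2, y3⟩ a b ha hb hab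
  refine ⟨fun j hj => by simp [x1 j hj, y1 j hj], ?_, fun δ hδ => ?_⟩
  · simp only [Pi.add_apply, Pi.smul_apply, smul_eq_mul, Finset.sum_add_distrib, ← Finset.mul_sum,
      x2, y2]
    rw [← add_mul, hab, one_mul]
  · simp only [Pi.add_apply, Pi.smul_apply, smul_eq_mul, Finset.sum_add_distrib, ← Finset.mul_sum]
    have h1 := mul_le_mul_of_nonneg_left (x3 δ hδ) ha
    have h2 := mul_le_mul_of_nonneg_left (y3 δ hδ) hb
    have h3 : b = 1 - a := by linarith
    subst h3
    linarith

theorem finite_triangulationPoints (n : ℕ) (D U : Finset ℕ) :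
    (triangulationPoints n D U).Finite := by
  refine ((Finset.finite_toSet (allTri n D U)).image (xcoord n D U)).subset ?_
  rintro x ⟨T, hT, rfl⟩
  refine ⟨T, Finset.mem_coe.2 (Finset.mem_filter.2 ⟨Finset.mem_powerset.2 fun δ hδ => ?_, hT⟩), rfl⟩
  have h := hT.1 δ hδ
  have h1 := h.1.1
  have h2 := h.1.2
  refine Finset.mem_filter.2 ⟨Finset.mem_product.2 ⟨?_, ?_⟩, h⟩ <;> rw [Finset.mem_range] <;> omega

theorem map_eq_sum_of_support {s : Finset ℕ} (f : (ℕ → ℝ) →ₗ[ℝ] ℝ) {x : ℕ → ℝ}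
    (hx : ∀ j ∉ s, x j = 0) : f x = ∑ j ∈ s, f (Pi.single j 1) * x j := by
  have h : x = ∑ j ∈ s, x j • Pi.single j (1 : ℝ) := by
    funext i
    by_cases hi : i ∈ s
    · simp [Finset.sum_apply, Pi.single_apply, hi]
    · simp [Finset.sum_apply, Pi.single_apply, hi, hx i hi]
  conv_lhs => rw [h]
  simp [map_sum, mul_comm]

theorem convexHull_triangulationPoints {n : ℕ} {D U : Finset ℕ}
    (hUD : D ∪ U = Finset.Icc 1 (n + 1)) (hdisj : Disjoint D U) :
    convexHull ℝ (triangulationPoints n D U) = diagonalPolytope n D U := by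
  refine (convexHull_min ?_ (convex_diagonalPolytope n D U)).antisymm fun y hy => ?_
  · rintro x ⟨T, hT, rfl⟩
    exact xcoord_mem_diagonalPolytope hUD hdisj hT
  · by_contra hcon
    obtain ⟨f, u, hfy, hfu⟩ := geometric_hahn_banach_point_closed
      (convex_convexHull ℝ (triangulationPoints n D U))
      (Set.Finite.isClosed_convexHull (𝕜 := ℝ) (finite_triangulationPoints n D U)) hcon
    obtain ⟨T, hT, hmin⟩ := exists_triangulation_minimizing hUD hdisj
      (fun j => f (Pi.single j 1))
    obtain ⟨y1, y2, y3⟩ := mem_diagonalPolytope_iff.1 hy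
    have h1 := hmin (centered n y) y2 fun S hS => lowerBound_le_sum hUD hdisj y2 y3 hS
    have h2 := hfu _ (subset_convexHull ℝ _ ⟨T, hT, rfl⟩)
    have e1 := map_eq_sum_of_support f.toLinearMap y1
    have e2 := map_eq_sum_of_support f.toLinearMap
      (fun j hj => xcoord_eq_zero hj : ∀ j ∉ Finset.Icc 1 (n + 1), xcoord n D U T j = 0)
    simp only [ContinuousLinearMap.coe_coe] at e1 e2
    rw [e1] at hfy
    rw [e2] at h2
    simp only [centered, mul_sub, Finset.sum_sub_distrib] at h1
    linarith

/-- The vectors `e_{i+2} - e_1`. -/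
def edgeVector {n : ℕ} (i : Fin n) : ℕ → ℝ := Pi.single ((i : ℕ) + 2) 1 - Pi.single 1 1

theorem linearIndependent_edgeVector (n : ℕ) :
    LinearIndependent ℝ (edgeVector : Fin n → ℕ → ℝ) := by
  rw [Fintype.linearIndependent_iff]
  intro g hg i
  have h := congrFun hg ((i : ℕ) + 2)
  simpa [edgeVector, Finset.sum_apply, Pi.single_apply, Fin.val_inj] using h

theorem sum_Icc_eq (n : ℕ) (v : ℕ → ℝ) :
    ∑ j ∈ Finset.Icc 1 (n + 1), v j = v 1 + ∑ i : Fin n, v ((i : ℕ) + 2) := by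
  rw [Fin.sum_univ_eq_sum_range (fun i => v (i + 2)) n, ← Finset.sum_Ioc_add_eq_sum_Icc (by omega),
    add_comm]
  congr 1
  rw [Finset.sum_bij (fun i _ => i - 2)]
  · intro i hi
    simp at hi ⊢; omega
  · intro i hi j hj h
    simp at hi hj; omega
  · intro i hi
    simp at hi
    exact ⟨i + 2, by simp; omega, by omega⟩
  · intro i hi
    simp at hi
    congr 1; omega

theorem mem_span_edgeVector {n : ℕ} {v : ℕ → ℝ} (hv : ∀ j ∉ Finset.Icc 1 (n + 1), v j = 0)
    (hsum : ∑ j ∈ Finset.Icc 1 (n + 1), v j = 0) :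
    v ∈ Submodule.span ℝ (Set.range (edgeVector : Fin n → ℕ → ℝ)) := by
  have h : v = ∑ i : Fin n, v ((i : ℕ) + 2) • edgeVector i := by
    rw [sum_Icc_eq] at hsum
    funext j
    by_cases hj : j ∈ Finset.Icc 2 (n + 1)
    · rw [Finset.mem_Icc] at hj
      obtain ⟨i, rfl⟩ : ∃ i : Fin n, (i : ℕ) + 2 = j := ⟨⟨j - 2, by omega⟩, by simp; omega⟩
      simp [edgeVector, Finset.sum_apply, Pi.single_apply, Fin.val_inj]
    · have hne : ∀ i : Fin n, j ≠ (i : ℕ) + 2 := by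
        intro i hi
        rw [Finset.mem_Icc] at hj
        omega
      by_cases hj1 : j = 1
      · subst hj1
        simp [edgeVector, Finset.sum_apply]
        linarith
      · rw [hv j (by rw [Finset.mem_Icc] at hj ⊢; omega)]
        simp [edgeVector, Finset.sum_apply, hne, hj1]
  rw [h]
  exact Submodule.sum_mem _ fun i _ => Submodule.smul_mem _ _ (Submodule.subset_span ⟨i, rfl⟩)

/-- The point with all coordinates equal to `(n + 2) / 2`. -/
def centerPoint (n : ℕ) (j : ℕ) : ℝ := if j ∈ Finset.Icc 1 (n + 1) then ((n : ℝ) + 2) / 2 else 0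

theorem sum_centerPoint {n : ℕ} {S : Finset ℕ} (hS : S ⊆ Finset.Icc 1 (n + 1)) :
    ∑ j ∈ S, centerPoint n j = S.card * ((n + 2) / 2) := by
  have h : ∀ j ∈ S, centerPoint n j = ((n : ℝ) + 2) / 2 := fun j hj => if_pos (hS hj)
  rw [Finset.sum_congr rfl h, Finset.sum_const, nsmul_eq_mul]

theorem sum_edgeVector {n : ℕ} (i : Fin n) (S : Finset ℕ) :
    ∑ j ∈ S, edgeVector i j = (if (i : ℕ) + 2 ∈ S then 1 else 0) - (if 1 ∈ S then 1 else 0) := by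
  simp [edgeVector, Finset.sum_sub_distrib, Finset.sum_pi_single']

theorem add_smul_edgeVector_mem {n : ℕ} {D U : Finset ℕ} (hUD : D ∪ U = Finset.Icc 1 (n + 1))
    (hdisj : Disjoint D U) (i : Fin n) {t : ℝ} (h0 : 0 ≤ t) (ht : t ≤ 1 / 2) :
    centerPoint n + t • edgeVector i ∈ diagonalPolytope n D U := by
  have hsum : ∀ S ⊆ Finset.Icc 1 (n + 1), ∑ j ∈ S, (centerPoint n + t • edgeVector i) j
      = S.card * ((n + 2) / 2) + t * ∑ j ∈ S, edgeVector i j := by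
    intro S hS
    simp only [Pi.add_apply, Pi.smul_apply, smul_eq_mul, Finset.sum_add_distrib,
      sum_centerPoint hS, Finset.mul_sum]
  refine ⟨fun j hj => ?_, ?_, fun δ hδ => ?_⟩
  · have hj' := hj
    rw [Finset.mem_Icc] at hj'
    have h1 : j ≠ (i : ℕ) + 2 := by have := i.2; omega
    have h2 : j ≠ 1 := by omega
    simp only [Pi.add_apply, Pi.smul_apply, centerPoint, if_neg hj]
    simp [edgeVector, h1, h2]
  · rw [hsum _ subset_rfl, sum_edgeVector, if_pos (Finset.mem_Icc.2 ⟨by omega, by omega⟩),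
      if_pos (Finset.mem_Icc.2 ⟨le_rfl, by omega⟩), Nat.card_Icc]
    push_cast
    ring
  · rw [hsum (Bel n D U δ) (Finset.filter_subset _ _), sum_edgeVector]
    obtain ⟨b1, b2⟩ := bel_of_isInternalDiag hUD hdisj hδ
    change _ ≤ (bel n D U δ : ℝ) * _ + _
    have c1 : (1 : ℝ) ≤ bel n D U δ := by exact_mod_cast b1
    have c2 : (bel n D U δ : ℝ) ≤ n := by exact_mod_cast b2
    have key : (1 : ℝ) ≤ bel n D U δ * (n + 1 - bel n D U δ) := by nlinarith
    have hle : -1 ≤ (if (i : ℕ) + 2 ∈ Bel n D U δ then (1 : ℝ) else 0)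
        - (if 1 ∈ Bel n D U δ then 1 else 0) := by
      split_ifs <;> norm_num
    have := mul_le_mul_of_nonneg_left hle h0
    linarith

theorem vectorSpan_diagonalPolytope {n : ℕ} {D U : Finset ℕ}
    (hUD : D ∪ U = Finset.Icc 1 (n + 1)) (hdisj : Disjoint D U) :
    vectorSpan ℝ (diagonalPolytope n D U)
      = Submodule.span ℝ (Set.range (edgeVector : Fin n → ℕ → ℝ)) := by
  apply le_antisymm
  · rw [vectorSpan_def, Submodule.span_le]
    rintro _ ⟨x, ⟨x1, x2, -⟩, y, ⟨y1, y2, -⟩, rfl⟩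
    refine mem_span_edgeVector (fun j hj => ?_) ?_
    · simp [x1 j hj, y1 j hj]
    · simp [Finset.sum_sub_distrib, x2, y2]
  · rw [Submodule.span_le]
    rintro _ ⟨i, rfl⟩
    have h := vsub_mem_vectorSpan ℝ
      (add_smul_edgeVector_mem hUD hdisj i (by norm_num : (0 : ℝ) ≤ 1 / 2) le_rfl)
      (add_smul_edgeVector_mem hUD hdisj i le_rfl (by norm_num))
    have h' := Submodule.smul_mem _ (2 : ℝ) h
    simpa [smul_smul] using h'

/-- The convex hull of the points `x(T)` over all triangulations `T`
of `P` equals the set of points `x ∈ ℝ^{n+1}` (encoded as functions `ℕ → ℝ` supported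
on `[n+1] = {1,…,n+1}`) satisfying `∑_{j∈[n+1]} x j = (n+2)(n+1)/2` and
`∑_{j∈Bel(δ)} x j ≥ (bel(δ)+1)·bel(δ)/2` for every internal diagonal `δ`;
moreover this polytope has dimension `n`. -/
theorem associahedron_hull_eq_halfspaces (n : ℕ) (hn : 1 ≤ n) (D U : Finset ℕ)
    (hUD : D ∪ U = Finset.Icc 1 (n + 1)) (hdisj : Disjoint D U) :
    convexHull ℝ {x : ℕ → ℝ | ∃ T : Finset (ℕ × ℕ),
        IsTriangulation n D U T ∧ x = xcoord n D U T}
      = {x : ℕ → ℝ |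
          (∀ j : ℕ, j ∉ Finset.Icc 1 (n + 1) → x j = 0) ∧
          (∑ j ∈ Finset.Icc 1 (n + 1), x j = ((n : ℝ) + 2) * ((n : ℝ) + 1) / 2) ∧
          (∀ δ : ℕ × ℕ, IsInternalDiag n D U δ →
            ((bel n D U δ : ℝ) + 1) * (bel n D U δ : ℝ) / 2 ≤ ∑ j ∈ Bel n D U δ, x j)} ∧
    Module.finrank ℝ
      (vectorSpan ℝ (convexHull ℝ {x : ℕ → ℝ | ∃ T : Finset (ℕ × ℕ),
        IsTriangulation n D U T ∧ x = xcoord n D U T})) = n := by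
  change convexHull ℝ (triangulationPoints n D U) = diagonalPolytope n D U ∧
    Module.finrank ℝ (vectorSpan ℝ (convexHull ℝ (triangulationPoints n D U))) = n
  rw [convexHull_triangulationPoints hUD hdisj, vectorSpan_diagonalPolytope hUD hdisj,
    finrank_span_eq_card (linearIndependent_edgeVector n), Fintype.card_fin]
  exact ⟨rfl, rfl⟩

end Spines
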